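/- The elements R ∈ Q⊗Q and Φ ∈ Q⊗Q⊗Q satisfy the two hexagon identities of a quasi-triangular quasi-bialgebra: (Δ⊗id)(R) = Φ₂₃₁^{-1}·R₁₃·Φ₁₃₂·R₂₃·Φ^{-1} and (id⊗Δ)(R) = Φ₃₁₂·R₁₃·Φ₂₁₃^{-1}·R₁₂·Φ. Consequently (together with the invertibility and counitality of Φ, the cocycle and intertwining properties of Φ, the invertibility of R and the identity R·Δ(a) = Δ^op(a)·R) the pair (Q, Φ, R) is a quasi-triangular quasi-bialgebra. -/

import Mathlib

open TensorProduct

set_option maxHeartbeats 1000000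
set_option synthInstance.maxHeartbeats 400000

noncomputable section

/-- Generators of the restricted quantum group `Q = \bar U_i sl(2)`. -/
inductive QGen : Type
  | E | F | K | Kinv
deriving DecidableEq

/-- The free algebra on the generators. -/
abbrev FA : Type := FreeAlgebra ℂ QGen

def ιE : FA := FreeAlgebra.ι ℂ QGen.E
def ιF : FA := FreeAlgebra.ι ℂ QGen.F
def ιK : FA := FreeAlgebra.ι ℂ QGen.K
def ιKi : FA := FreeAlgebra.ι ℂ QGen.Kinv

/-- Defining relations of `\bar U_i sl(2)` (at `q = i`, i.e. `p = 2`). -/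
inductive QRel : FA → FA → Prop
  | KKi : QRel (ιK * ιKi) 1
  | KiK : QRel (ιKi * ιK) 1
  | KEKi : QRel (ιK * ιE * ιKi) (-ιE)
  | KFKi : QRel (ιK * ιF * ιKi) (-ιF)
  | EF : QRel (ιE * ιF - ιF * ιE) ((2 * Complex.I)⁻¹ • (ιK - ιKi))
  | Esq : QRel (ιE ^ 2) 0
  | Fsq : QRel (ιF ^ 2) 0
  | K4 : QRel (ιK ^ 4) 1

/-- The restricted quantum group `\bar U_i sl(2)`: the quotient of the free algebra
by the two-sided ideal generated by the defining relations. -/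
abbrev Q : Type := RingQuot QRel

def gE : Q := RingQuot.mkAlgHom ℂ QRel ιE
def gF : Q := RingQuot.mkAlgHom ℂ QRel ιF
def gK : Q := RingQuot.mkAlgHom ℂ QRel ιK
def gKi : Q := RingQuot.mkAlgHom ℂ QRel ιKi

section Gadgets

variable (k : Type) [Field k] (A : Type) [Ring A] [Algebra k A]

abbrev TP2 : Type := A ⊗[k] A
abbrev TP3 : Type := A ⊗[k] (A ⊗[k] A)
abbrev TP4 : Type := A ⊗[k] (A ⊗[k] (A ⊗[k] A))

/-- Multiplication `a ⊗ b ↦ a * b`. -/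
def mulA : TP2 k A →ₗ[k] A := LinearMap.mul' k A

/-- Tensor flip `a ⊗ b ↦ b ⊗ a`. -/
def flipA : TP2 k A →ₗ[k] TP2 k A := (TensorProduct.comm k A A).toLinearMap

/-- `a ↦ a ⊗ 1`. -/
def lTen : A →ₗ[k] TP2 k A := (TensorProduct.mk k A A).flip 1

/-- `a ↦ 1 ⊗ a`. -/
def rTen : A →ₗ[k] TP2 k A := TensorProduct.mk k A A 1

/-- `a ⊗ b ↦ a ⊗ b ⊗ 1`. -/
def emb12 : TP2 k A →ₗ[k] TP3 k A := TensorProduct.map LinearMap.id (lTen k A)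

/-- `a ⊗ b ↦ a ⊗ 1 ⊗ b`. -/
def emb13 : TP2 k A →ₗ[k] TP3 k A := TensorProduct.map LinearMap.id (rTen k A)

/-- `a ⊗ b ↦ 1 ⊗ a ⊗ b`. -/
def emb23 : TP2 k A →ₗ[k] TP3 k A := TensorProduct.mk k A (TP2 k A) 1

/-- `a ⊗ b ⊗ c ↦ a ⊗ c ⊗ b`. -/
def perm132 : TP3 k A →ₗ[k] TP3 k A := TensorProduct.map LinearMap.id (flipA k A)

/-- `a ⊗ b ⊗ c ↦ b ⊗ c ⊗ a`. -/
def perm231 : TP3 k A →ₗ[k] TP3 k A :=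
  (TensorProduct.assoc k A A A).toLinearMap ∘ₗ (TensorProduct.comm k A (TP2 k A)).toLinearMap

/-- `a ⊗ b ⊗ c ↦ c ⊗ a ⊗ b`. -/
def perm312 : TP3 k A →ₗ[k] TP3 k A :=
  (TensorProduct.comm k (TP2 k A) A).toLinearMap ∘ₗ (TensorProduct.assoc k A A A).symm.toLinearMap

/-- `a ⊗ b ⊗ c ↦ b ⊗ a ⊗ c`. -/
def perm213 : TP3 k A →ₗ[k] TP3 k A :=
  (TensorProduct.assoc k A A A).toLinearMap ∘ₗ
    (TensorProduct.map (flipA k A) LinearMap.id) ∘ₗ (TensorProduct.assoc k A A A).symm.toLinearMap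

variable {k A}

/-- `(Δ ⊗ id)` on two tensor factors, landing in the triple tensor product. -/
def copL (D : A →ₐ[k] TP2 k A) : TP2 k A →ₗ[k] TP3 k A :=
  (TensorProduct.assoc k A A A).toLinearMap ∘ₗ TensorProduct.map D.toLinearMap LinearMap.id

/-- `(id ⊗ Δ)` on two tensor factors. -/
def copR (D : A →ₐ[k] TP2 k A) : TP2 k A →ₗ[k] TP3 k A :=
  TensorProduct.map LinearMap.id D.toLinearMap

/-- `(ε ⊗ id) : A ⊗ A → A`. -/
def cuL (ce : A →ₐ[k] k) : TP2 k A →ₗ[k] A :=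
  (TensorProduct.lid k A).toLinearMap ∘ₗ TensorProduct.map ce.toLinearMap LinearMap.id

/-- `(id ⊗ ε) : A ⊗ A → A`. -/
def cuR (ce : A →ₐ[k] k) : TP2 k A →ₗ[k] A :=
  (TensorProduct.rid k A).toLinearMap ∘ₗ TensorProduct.map LinearMap.id ce.toLinearMap

/-- `(id ⊗ ε ⊗ id) : A ⊗ A ⊗ A → A ⊗ A`. -/
def cuMid (ce : A →ₐ[k] k) : TP3 k A →ₗ[k] TP2 k A :=
  TensorProduct.map LinearMap.id (cuL ce)

/-- `(Δ ⊗ id ⊗ id)`. -/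
def cop4_1 (D : A →ₐ[k] TP2 k A) : TP3 k A →ₗ[k] TP4 k A :=
  (TensorProduct.assoc k A A (TP2 k A)).toLinearMap ∘ₗ TensorProduct.map D.toLinearMap LinearMap.id

/-- `(id ⊗ Δ ⊗ id)`. -/
def cop4_2 (D : A →ₐ[k] TP2 k A) : TP3 k A →ₗ[k] TP4 k A :=
  TensorProduct.map LinearMap.id (copL D)

/-- `(id ⊗ id ⊗ Δ)`. -/
def cop4_3 (D : A →ₐ[k] TP2 k A) : TP3 k A →ₗ[k] TP4 k A :=
  TensorProduct.map LinearMap.id (copR D)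

/-- `a ⊗ b ⊗ c ↦ a ⊗ b ⊗ c ⊗ 1`, i.e. `Φ ↦ Φ ⊗ 1`. -/
def pad4 : TP3 k A →ₗ[k] TP4 k A :=
  TensorProduct.map LinearMap.id (TensorProduct.map LinearMap.id (lTen k A))

/-- `a ⊗ b ⊗ c ↦ f(a) * g(b) * h(c)`. -/
def tmap3 (f g h : A →ₗ[k] A) : TP3 k A →ₗ[k] A :=
  mulA k A ∘ₗ TensorProduct.map f (mulA k A ∘ₗ TensorProduct.map g h)

/-- `a ⊗ b ↦ S(a) * b`, used in the antipode axiom `m ∘ (S ⊗ id) ∘ Δ = 1·ε`. -/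
def antipL (s : A →ₗ[k] A) : TP2 k A →ₗ[k] A := mulA k A ∘ₗ TensorProduct.map s LinearMap.id

/-- `a ⊗ b ↦ a * S(b)`. -/
def antipR (s : A →ₗ[k] A) : TP2 k A →ₗ[k] A := mulA k A ∘ₗ TensorProduct.map LinearMap.id s

end Gadgets

/-- Central idempotent `e₀ = (1 + K²)/2`. -/
def e0 : Q := (2:ℂ)⁻¹ • (1 + gK ^ 2)

/-- Central idempotent `e₁ = (1 − K²)/2`. -/
def e1 : Q := (2:ℂ)⁻¹ • (1 - gK ^ 2)

/-- `f⁺ = −i F`. -/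
def fp : Q := (-Complex.I) • gF

/-- `f⁻ = E K⁻¹`. -/
def fm : Q := gE * gKi

/-- The Casimir element `C = FE − (i/4)(K − K⁻¹)`. -/
def Cas : Q := gF * gE - (Complex.I / 4) • (gK - gKi)

def t2 (a b : Q) : TP2 ℂ Q := a ⊗ₜ[ℂ] b

def t3 (a b c : Q) : TP3 ℂ Q := a ⊗ₜ[ℂ] (b ⊗ₜ[ℂ] c)

def eEF : Q := gE * gF
def eEK : Q := gE * gK
def eFK : Q := gF * gK
def eEFK : Q := gE * gF * gK

/-- `Φ^{010}` component of the coassociator. -/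
def Phi010 : TP3 ℂ Q :=
  t3 1 1 1 - (1 + Complex.I) • t3 gE gK gF + (1 - Complex.I) • t3 eFK gK eEK
    + (2:ℂ) • t3 eEFK 1 eEFK

/-- `Φ^{101}` component of the coassociator. -/
def Phi101 : TP3 ℂ Q :=
  (Complex.I - 1) • t3 1 gF eEK + t3 1 gK 1 + (2:ℂ) • t3 1 eEF eEFK
    - (1 + Complex.I) • t3 1 eEK gF - (1 + Complex.I) • t3 gE eFK 1
    + (2 * Complex.I) • t3 gE eEFK gF + (1 - Complex.I) • t3 eFK gE 1
    - (2 * Complex.I) • t3 eFK eEFK eEK - (2:ℂ) • t3 eEFK eEF 1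

/-- `Φ^{111}` component of the coassociator. -/
def Phi111 (β : ℂ) : TP3 ℂ Q :=
  (Complex.I * β ^ 2) • (
    (1 + Complex.I) • t3 1 gF eEK - t3 1 gK 1 - (2:ℂ) • t3 1 eEF 1
      - (2 * Complex.I) • t3 1 eEF eEFK + (1 + Complex.I) • t3 1 eEK gF
      - (1 + Complex.I) • t3 gE 1 gF + (1 + Complex.I) • t3 gE eFK 1
      + (2 * Complex.I) • t3 gE eFK eEFK + (2:ℂ) • t3 gE eEFK gF
      - (1 + Complex.I) • t3 eFK 1 eEK + (1 + Complex.I) • t3 eFK gE 1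
      + (2 * Complex.I) • t3 eFK gE eEFK + (2:ℂ) • t3 eFK eEFK eEK
      + (2 * Complex.I) • t3 eEFK gF eEK + (2 * Complex.I) • t3 eEFK gK eEFK
      - (2 * Complex.I) • t3 eEFK eEF 1 + (2 * Complex.I) • t3 eEFK eEK gF
      + (4:ℂ) • t3 eEFK eEF eEFK)

/-- The coassociator `Φ` of the quasi-Hopf algebra structure on `Q`. -/
def Phi (β : ℂ) : TP3 ℂ Q :=
  t3 e0 e0 e0 + t3 e1 e0 e0 + Phi010 * t3 e0 e1 e0 + t3 e0 e0 e1
    + t3 e1 e1 e0 + Phi101 * t3 e1 e0 e1 + t3 e0 e1 e1 + Phi111 β * t3 e1 e1 e1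

def R00 : TP2 ℂ Q :=
  (2:ℂ)⁻¹ • ((t2 1 1 + t2 1 gK + t2 gK 1 - t2 gK gK) * (t2 1 1 + (2 * Complex.I) • t2 gE gF))

def R01 : TP2 ℂ Q :=
  (2:ℂ)⁻¹ • ((t2 1 1 - Complex.I • t2 1 gK + t2 gK 1 + Complex.I • t2 gK gK) *
    (t2 1 1 + (1 - Complex.I) • t2 eFK eEK - (1 - Complex.I) • t2 gE gF
      + (1 + Complex.I) • t2 eEFK 1 + (2 * Complex.I) • t2 eEFK eEFK))

def R10 : TP2 ℂ Q :=
  (2:ℂ)⁻¹ • ((t2 1 1 + t2 1 gK - Complex.I • t2 gK 1 + Complex.I • t2 gK gK) *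
    (t2 1 gK + (1 - Complex.I) • t2 eFK gE + (1 - Complex.I) • t2 gE eFK
      - (1 - Complex.I) • t2 1 eEF - (2 * Complex.I) • t2 eEFK eEF))

def R11 (β : ℂ) : TP2 ℂ Q :=
  (β / 2) • ((t2 1 1 - Complex.I • t2 1 gK - Complex.I • t2 gK 1 + t2 gK gK) *
    ((-Complex.I) • t2 gK 1 + (2 * Complex.I) • t2 eEK gF + (1 - Complex.I) • t2 gK eEFK
      - (1 + Complex.I) • t2 eEF 1 - (2 * Complex.I) • t2 eEF eEFK))

/-- The universal R-matrix `R` of the quasi-triangular quasi-Hopf structure on `Q`. -/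
def Rmat (β : ℂ) : TP2 ℂ Q :=
  R00 * t2 e0 e0 + R01 * t2 e0 e1 + R10 * t2 e1 e0 + R11 β * t2 e1 e1

/-- The standard R-matrix `R_st` of the quotient `Q/(K²-1)`. -/
def Rst : TP2 ℂ Q :=
  (2:ℂ)⁻¹ • ∑ m ∈ Finset.range 2, ∑ n ∈ Finset.range 2,
    ((-1:ℂ) ^ (m * n)) • (t2 (gK ^ m) (gK ^ n) * (t2 1 1 + (2 * Complex.I) • t2 gE gF))

/-- The monodromy matrix `M = R₂₁ · R`. -/
def Mmat (β : ℂ) : TP2 ℂ Q := flipA ℂ Q (Rmat β) * Rmat β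

/-- The ribbon element `v = (e₀ − iβ K e₁)(1 − 2 f⁺ f⁻)`. -/
def vRib (β : ℂ) : Q := (e0 - (Complex.I * β) • (gK * e1)) * (1 - (2:ℂ) • (fp * fm))

/-- The coevaluation element `β = e₀ − 2iβ² C e₁`. -/
def bbEl (β : ℂ) : Q := e0 - (2 * Complex.I * β ^ 2) • (Cas * e1)

/-- `b ⊗ c ↦ S(b · bb · S(c))`, inner part of the Drinfeld element. -/
def uInner (S : Q →ₗ[ℂ] Q) (bb : Q) : TP2 ℂ Q →ₗ[ℂ] Q :=
  S ∘ₗ mulA ℂ Q ∘ₗ TensorProduct.map (LinearMap.mulRight ℂ bb) S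

/-- `Φ' ⊗ Φ'' ⊗ Φ''' ↦ S(Φ'' · bb · S(Φ''')) ⊗ Φ'`. -/
def uMap1 (S : Q →ₗ[ℂ] Q) (bb : Q) : TP3 ℂ Q →ₗ[ℂ] TP2 ℂ Q :=
  TensorProduct.map (uInner S bb) LinearMap.id ∘ₗ (TensorProduct.comm ℂ Q (TP2 ℂ Q)).toLinearMap

/-- `R' ⊗ R'' ↦ S(R'') · al · R'`. -/
def uMap2 (S : Q →ₗ[ℂ] Q) (al : Q) : TP2 ℂ Q →ₗ[ℂ] Q :=
  mulA ℂ Q ∘ₗ TensorProduct.map (LinearMap.mulRight ℂ al ∘ₗ S) LinearMap.id ∘ₗ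
    (TensorProduct.comm ℂ Q Q).toLinearMap

/-- `(x ⊗ a) ⊗ (R' ⊗ R'') ↦ x · (S(R'') · al · R') · a`. -/
def uBig (S : Q →ₗ[ℂ] Q) (al : Q) : TP2 ℂ Q ⊗[ℂ] TP2 ℂ Q →ₗ[ℂ] Q :=
  mulA ℂ Q ∘ₗ TensorProduct.map LinearMap.id (mulA ℂ Q ∘ₗ (TensorProduct.comm ℂ Q Q).toLinearMap)
    ∘ₗ (TensorProduct.assoc ℂ Q Q Q).toLinearMap ∘ₗ TensorProduct.map LinearMap.id (uMap2 S al)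

/-- The Drinfeld element `u = Σ S(Φ''·b·S(Φ'''))·S(R'')·α·R'·Φ'` (with `α = 1`). -/
def uDrin (β : ℂ) (S : Q →ₗ[ℂ] Q) : Q :=
  uBig S 1 (uMap1 S (bbEl β) (Phi β) ⊗ₜ[ℂ] Rmat β)

/-- The balancing element `g = b · S(α) · v⁻¹ · u` (with `α = 1`). -/
def balG (β : ℂ) (S : Q →ₗ[ℂ] Q) : Q :=
  bbEl β * S 1 * Ring.inverse (vRib β) * uDrin β S

/-- The cointegral `c = (β²/i)·E·F·(1 + K + K² + K³)`. -/
def cInt (β : ℂ) : Q := (β ^ 2 / Complex.I) • (gE * gF * (1 + gK + gK ^ 2 + gK ^ 3))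

/-- The q-trace of a one-dimensional representation, with balancing element `K⁻¹`. -/
def qTr1 (ρ : Q →ₐ[ℂ] ℂ) : Q →ₗ[ℂ] ℂ := ρ.toLinearMap ∘ₗ LinearMap.mulLeft ℂ gK

/-- The q-trace of a two-dimensional (matrix) representation, with balancing element `K⁻¹`. -/
def qTrM (ρ : Q →ₐ[ℂ] Matrix (Fin 2) (Fin 2) ℂ) : Q →ₗ[ℂ] ℂ :=
  Matrix.traceLinearMap (Fin 2) ℂ ℂ ∘ₗ ρ.toLinearMap ∘ₗ LinearMap.mulLeft ℂ gK

/-- The Drinfeld mapping `φ ↦ (φ ⊗ id)(M)`. -/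
def drinfeldImg (β : ℂ) (φ : Q →ₗ[ℂ] ℂ) : Q :=
  (TensorProduct.lid ℂ Q) (TensorProduct.map φ LinearMap.id (Mmat β))

set_option linter.unusedVariables false
/-! ### Computable model -/

/-- Gaussian integers `a + b j`, with a syntactic zero and purely real or imaginary elements. -/
inductive G : Type
  | o | r (a : Int) | i (b : Int) | c (a b : Int)

def isz0 (x : Int) : Bool := Int.rec (fun n => Nat.beq n 0) (fun _ => false) x

def G.mr (a : Int) : G := cond (isz0 a) .o (.r a)
def G.mi (a : Int) : G := cond (isz0 a) .o (.i a)
def G.mk (a b : Int) : G := cond (isz0 a) (G.mi b) (cond (isz0 b) (.r a) (.c a b))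

def G.add (x y : G) : G :=
  G.rec y
    (fun a => G.rec x (fun a' => G.mr (Int.add a a')) (fun b' => .c a b')
      (fun a' b' => G.mk (Int.add a a') b') y)
    (fun b => G.rec x (fun a' => .c a' b) (fun b' => G.mi (Int.add b b'))
      (fun a' b' => G.mk a' (Int.add b b')) y)
    (fun a b => G.rec x (fun a' => G.mk (Int.add a a') b) (fun b' => G.mk a (Int.add b b'))
      (fun a' b' => G.mk (Int.add a a') (Int.add b b')) y) x

def G.mul (x y : G) : G :=
  G.rec .o
    (fun a => G.rec .o (fun a' => .r (Int.mul a a')) (fun b' => .i (Int.mul a b'))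
      (fun a' b' => .c (Int.mul a a') (Int.mul a b')) y)
    (fun b => G.rec .o (fun a' => .i (Int.mul b a')) (fun b' => .r (Int.neg (Int.mul b b')))
      (fun a' b' => .c (Int.neg (Int.mul b b')) (Int.mul b a')) y)
    (fun a b => G.rec .o (fun a' => .c (Int.mul a a') (Int.mul b a'))
      (fun b' => .c (Int.neg (Int.mul b b')) (Int.mul a b'))
      (fun a' b' => G.mk (Int.add (Int.mul a a') (Int.neg (Int.mul b b')))
        (Int.add (Int.mul a b') (Int.mul b a'))) y) x

/-- Multiplication by `j`. -/
def G.jm (x : G) : G := G.rec .o (fun a => .i a) (fun b => .r (Int.neg b)) (fun a b => .c (Int.neg b) a) x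

def G.isz (x : G) : Bool := G.rec true (fun a => isz0 a) (fun a => isz0 a) (fun a b => isz0 a && isz0 b) x

def G.nul (x : G) : Bool := G.rec true (fun _ => false) (fun _ => false) (fun _ _ => false) x

def G.half (x : G) : G := G.rec .o (fun a => .r (Int.ediv a 2)) (fun a => .i (Int.ediv a 2))
  (fun a b => .c (Int.ediv a 2) (Int.ediv b 2)) x

/-- The ring of integers of the eighth cyclotomic field: `x + y β` with `β ^ 2 = j`. -/
inductive L : Type
  | o | e (x : G) | d (y : G) | c (x y : G)

def L.me (x : G) : L := cond (G.nul x) .o (.e x)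
def L.md (x : G) : L := cond (G.nul x) .o (.d x)
def L.mk (x y : G) : L := cond (G.nul x) (L.md y) (cond (G.nul y) (.e x) (.c x y))

def L.add (x y : L) : L :=
  L.rec y
    (fun a => L.rec x (fun a' => L.me (G.add a a')) (fun b' => .c a b')
      (fun a' b' => L.mk (G.add a a') b') y)
    (fun b => L.rec x (fun a' => .c a' b) (fun b' => L.md (G.add b b'))
      (fun a' b' => L.mk a' (G.add b b')) y)
    (fun a b => L.rec x (fun a' => L.mk (G.add a a') b) (fun b' => L.mk a (G.add b b'))
      (fun a' b' => L.mk (G.add a a') (G.add b b')) y) x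

def L.mul (x y : L) : L :=
  L.rec .o
    (fun a => L.rec .o (fun a' => .e (G.mul a a')) (fun b' => .d (G.mul a b'))
      (fun a' b' => .c (G.mul a a') (G.mul a b')) y)
    (fun b => L.rec .o (fun a' => .d (G.mul b a')) (fun b' => .e (G.jm (G.mul b b')))
      (fun a' b' => .c (G.jm (G.mul b b')) (G.mul b a')) y)
    (fun a b => L.rec .o (fun a' => .c (G.mul a a') (G.mul b a'))
      (fun b' => .c (G.jm (G.mul b b')) (G.mul a b'))
      (fun a' b' => L.mk (G.add (G.mul a a') (G.jm (G.mul b b')))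
        (G.add (G.mul a b') (G.mul b a'))) y) x

def L.isz (x : L) : Bool := L.rec true (fun a => G.isz a) (fun a => G.isz a) (fun a b => G.isz a && G.isz b) x

def L.nul (x : L) : Bool := L.rec true (fun _ => false) (fun _ => false) (fun _ _ => false) x

def L.half (x : L) : L := L.rec .o (fun a => .e (G.half a)) (fun a => .d (G.half a))
  (fun a b => .c (G.half a) (G.half b)) x

class Ops (A : Type) where
  zero : A
  add : A → A → A
  smul : L → A → A
  mul : A → A → A
  nul : A → Bool
  isz : A → Bool

instance : Ops L := ⟨.o, L.add, L.mul, L.mul, L.nul, L.isz⟩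

/-- The charge zero part of `Q ⊗ A`. -/
inductive Z8 (A : Type) : Type
  | o | n (x0 x1 x2 x3 x4 x5 x6 x7 : A)

/-- The part of charge one (or minus one) of `Q ⊗ A`. -/
inductive P4 (A : Type) : Type
  | o | n (x0 x1 x2 x3 : A)

/-- Elements of `Q ⊗ A`, by the sixteen coordinates. -/
inductive M (A : Type) : Type
  | o | n (c : Z8 A) (p m : P4 A)

def Z8.map {A B : Type} (g : A → B) (x : Z8 A) : Z8 B :=
  Z8.rec .o (fun x0 x1 x2 x3 x4 x5 x6 x7 => .n (g x0) (g x1) (g x2) (g x3) (g x4) (g x5) (g x6) (g x7)) x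

section
variable {A : Type} [Ops A]

def Z8.mk (x0 x1 x2 x3 x4 x5 x6 x7 : A) : Z8 A :=
  cond (Ops.nul x0 && Ops.nul x1 && Ops.nul x2 && Ops.nul x3 && Ops.nul x4 && Ops.nul x5 && Ops.nul x6 && Ops.nul x7) .o
    (.n x0 x1 x2 x3 x4 x5 x6 x7)

def Z8.add (x y : Z8 A) : Z8 A :=
  Z8.rec y (fun x0 x1 x2 x3 x4 x5 x6 x7 => Z8.rec x (fun y0 y1 y2 y3 y4 y5 y6 y7 =>
    Z8.mk (Ops.add x0 y0) (Ops.add x1 y1) (Ops.add x2 y2) (Ops.add x3 y3) (Ops.add x4 y4) (Ops.add x5 y5) (Ops.add x6 y6) (Ops.add x7 y7)) y) x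

def Z8.nul (x : Z8 A) : Bool := Z8.rec true (fun _ _ _ _ _ _ _ _ => false) x

def Z8.isz (x : Z8 A) : Bool :=
  Z8.rec true (fun x0 x1 x2 x3 x4 x5 x6 x7 => Ops.isz x0 && Ops.isz x1 && Ops.isz x2 && Ops.isz x3 && Ops.isz x4 && Ops.isz x5 && Ops.isz x6 && Ops.isz x7) x

def Z8.nrm (x : Z8 A) : Z8 A := Z8.rec .o (fun x0 x1 x2 x3 x4 x5 x6 x7 => Z8.mk x0 x1 x2 x3 x4 x5 x6 x7) x

def Z8.p (k : ℕ) (x : Z8 A) : A :=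
  Z8.rec Ops.zero (fun x0 x1 x2 x3 x4 x5 x6 x7 => match k with
    | 0 => x0
    | 1 => x1
    | 2 => x2
    | 3 => x3
    | 4 => x4
    | 5 => x5
    | 6 => x6
    | _ => x7) x

end

def P4.map {A B : Type} (g : A → B) (x : P4 A) : P4 B :=
  P4.rec .o (fun x0 x1 x2 x3 => .n (g x0) (g x1) (g x2) (g x3)) x

section
variable {A : Type} [Ops A]

def P4.mk (x0 x1 x2 x3 : A) : P4 A :=
  cond (Ops.nul x0 && Ops.nul x1 && Ops.nul x2 && Ops.nul x3) .o
    (.n x0 x1 x2 x3)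

def P4.add (x y : P4 A) : P4 A :=
  P4.rec y (fun x0 x1 x2 x3 => P4.rec x (fun y0 y1 y2 y3 =>
    P4.mk (Ops.add x0 y0) (Ops.add x1 y1) (Ops.add x2 y2) (Ops.add x3 y3)) y) x

def P4.nul (x : P4 A) : Bool := P4.rec true (fun _ _ _ _ => false) x

def P4.isz (x : P4 A) : Bool :=
  P4.rec true (fun x0 x1 x2 x3 => Ops.isz x0 && Ops.isz x1 && Ops.isz x2 && Ops.isz x3) x

def P4.nrm (x : P4 A) : P4 A := P4.rec .o (fun x0 x1 x2 x3 => P4.mk x0 x1 x2 x3) x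

def P4.p (k : ℕ) (x : P4 A) : A :=
  P4.rec Ops.zero (fun x0 x1 x2 x3 => match k with
    | 0 => x0
    | 1 => x1
    | 2 => x2
    | _ => x3) x

end

def M.map {A B : Type} (g : A → B) (x : M A) : M B :=
  M.rec .o (fun c p m => .n (Z8.map g c) (P4.map g p) (P4.map g m)) x

section
variable {A : Type} [Ops A]

def M.mk (c : Z8 A) (p m : P4 A) : M A :=
  cond (Z8.nul c && P4.nul p && P4.nul m) .o (.n c p m)

def M.add (x y : M A) : M A :=
  M.rec y (fun c p m => M.rec x (fun c' p' m' =>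
    M.mk (Z8.add c c') (P4.add p p') (P4.add m m')) y) x

def M.nul (x : M A) : Bool := M.rec true (fun _ _ _ => false) x

def M.isz (x : M A) : Bool := M.rec true (fun c p m => Z8.isz c && P4.isz p && P4.isz m) x

def M.nrm (x : M A) : M A := M.rec .o (fun c p m => M.mk (Z8.nrm c) (P4.nrm p) (P4.nrm m)) x

def M.pz (k : ℕ) (x : M A) : A := M.rec Ops.zero (fun c _ _ => Z8.p k c) x
def M.pp (k : ℕ) (x : M A) : A := M.rec Ops.zero (fun _ p _ => P4.p k p) x
def M.pm (k : ℕ) (x : M A) : A := M.rec Ops.zero (fun _ _ m => P4.p k m) x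

def mulZZ (x : Z8 A) (y : Z8 A) : Z8 A :=
  Z8.rec .o (fun x0 x1 x2 x3 x4 x5 x6 x7 => Z8.rec .o (fun y0 y1 y2 y3 y4 y5 y6 y7 =>
    Z8.mk (Ops.mul x0 y0) (Ops.add (Ops.mul x0 y1) (Ops.mul x1 y0)) (Ops.mul x2 y2) (Ops.add (Ops.mul x2 y3) (Ops.mul x3 y2)) (Ops.mul x4 y4) (Ops.mul x5 y5) (Ops.mul x6 y6) (Ops.mul x7 y7)) y) x

def mulZP (x : Z8 A) (y : P4 A) : P4 A :=
  Z8.rec .o (fun x0 x1 x2 x3 x4 x5 x6 x7 => P4.rec .o (fun y0 y1 y2 y3 =>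
    P4.mk (Ops.mul x2 y0) (Ops.mul x0 y1) (Ops.mul x4 y2) (Ops.mul x7 y3)) y) x

def mulPZ (x : P4 A) (y : Z8 A) : P4 A :=
  P4.rec .o (fun x0 x1 x2 x3 => Z8.rec .o (fun y0 y1 y2 y3 y4 y5 y6 y7 =>
    P4.mk (Ops.mul x0 y0) (Ops.mul x1 y2) (Ops.mul x2 y5) (Ops.mul x3 y6)) y) x

def mulZM (x : Z8 A) (y : P4 A) : P4 A :=
  Z8.rec .o (fun x0 x1 x2 x3 x4 x5 x6 x7 => P4.rec .o (fun y0 y1 y2 y3 =>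
    P4.mk (Ops.mul x2 y0) (Ops.mul x0 y1) (Ops.mul x5 y2) (Ops.mul x6 y3)) y) x

def mulMZ (x : P4 A) (y : Z8 A) : P4 A :=
  P4.rec .o (fun x0 x1 x2 x3 => Z8.rec .o (fun y0 y1 y2 y3 y4 y5 y6 y7 =>
    P4.mk (Ops.mul x0 y0) (Ops.mul x1 y2) (Ops.mul x2 y4) (Ops.mul x3 y7)) y) x

def mulPM (x : P4 A) (y : P4 A) : Z8 A :=
  P4.rec .o (fun x0 x1 x2 x3 => P4.rec .o (fun y0 y1 y2 y3 =>
    Z8.mk Ops.zero (Ops.mul x1 y0) Ops.zero (Ops.mul x0 y1) (Ops.mul x2 y2) Ops.zero Ops.zero (Ops.mul x3 y3)) y) x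

def mulMP (x : P4 A) (y : P4 A) : Z8 A :=
  P4.rec .o (fun x0 x1 x2 x3 => P4.rec .o (fun y0 y1 y2 y3 =>
    Z8.mk Ops.zero (Ops.mul x1 y0) Ops.zero (Ops.mul x0 y1) Ops.zero (Ops.mul x2 y2) (Ops.mul x3 y3) Ops.zero) y) x

def M.mul (x y : M A) : M A :=
  M.rec .o (fun c p m => M.rec .o (fun c' p' m' =>
    M.mk (Z8.add (mulZZ c c') (Z8.add (mulPM p m') (mulMP m p')))
      (P4.add (mulZP c p') (mulPZ p c')) (P4.add (mulZM c m') (mulMZ m c'))) y) x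

instance : Ops (M A) := ⟨.o, M.add, fun c => M.map (Ops.smul c), M.mul, M.nul, M.isz⟩

def smz (c : L) (a : A) : A := cond (L.nul c) Ops.zero (Ops.smul c a)

/-- The tensor product of an element of the model of `Q` with an element of `A`. -/
def M.t (x : M L) (a : A) : M A := M.map (fun c => smz c a) x

def colz (x : M (M A)) (k : ℕ) : M A := M.nrm (M.map (M.pz k) x)
def colp (x : M (M A)) (k : ℕ) : M A := M.nrm (M.map (M.pp k) x)
def colm (x : M (M A)) (k : ℕ) : M A := M.nrm (M.map (M.pm k) x)

def M.swap (x : M (M A)) : M (M A) :=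
  cond (M.nul x) .o (M.mk (Z8.mk (colz x 0) (colz x 1) (colz x 2) (colz x 3) (colz x 4) (colz x 5) (colz x 6) (colz x 7))
    (P4.mk (colp x 0) (colp x 1) (colp x 2) (colp x 3)) (P4.mk (colm x 0) (colm x 1) (colm x 2) (colm x 3)))

def M.bind2 (d : M (M L)) (a : A) : M (M A) :=
  cond (Ops.nul a) .o (M.map (M.map (fun c => smz c a)) d)

end

/-! ### Data -/

def lI (a b : Int) : L := .e (G.mk a b)
def cO : L := .e (.r 1)
def cN : L := .e (.r (-1))
def cB : L := .d (.r 1)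
/-- The imaginary unit; it is `β ^ 2` or `- β ^ 2`. -/
def ci : Bool → L
  | true => .e (.i 1)
  | false => .e (.i (-1))
/-- Minus the imaginary unit. -/
def cni : Bool → L
  | true => .e (.i (-1))
  | false => .e (.i 1)

/-- `a + b i` -/
def cg (s : Bool) (a b : Int) : L := L.add (lI a 0) (L.mul (lI b 0) (ci s))

def msub {A : Type} [Ops A] (x y : A) : A := Ops.add x (Ops.smul cN y)

instance : Add L := ⟨L.add⟩
instance {A : Type} [Ops A] : Add (M A) := ⟨M.add⟩
instance {A : Type} [Ops A] : Sub (M A) := ⟨msub⟩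
instance {A : Type} [Ops A] : Mul (M A) := ⟨M.mul⟩
instance {A : Type} [Ops A] : SMul L (M A) := ⟨Ops.smul⟩

def m1 : M L := .n (.n cO .o cO .o cO cO cO cO) .o .o
def mE : M L := .n .o (.n cO cO cO cO) .o
def mF : M L := .n .o .o (.n cO cO cO cN)
def mK (s : Bool) : M L := .n (.n cO .o cN .o (ci s) (cni s) (ci s) (cni s)) .o .o
def mKi (s : Bool) : M L := .n (.n cO .o cN .o (cni s) (ci s) (cni s) (ci s)) .o .o
def mw0 : M L := .n (.n cO .o .o .o .o .o .o .o) .o .o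
def mw1 : M L := .n (.n .o .o .o .o cO .o cO .o) .o .o
def mw2 : M L := .n (.n .o .o cO .o .o .o .o .o) .o .o
def mw3 : M L := .n (.n .o .o .o .o .o cO .o cO) .o .o
def me0 : M L := .n (.n cO .o cO .o .o .o .o .o) .o .o
def me1 : M L := .n (.n .o .o .o .o cO cO cO cO) .o .o
def mEF : M L := mE * mF
def mEK (s : Bool) : M L := mE * mK s
def mFK (s : Bool) : M L := mF * mK s
def mEFK (s : Bool) : M L := mE * mF * mK s

abbrev M2 := M (M L)
abbrev M3 := M (M (M L))
abbrev M4 := M (M (M (M L)))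

def mt2 (a b : M L) : M2 := M.t a b
def mt3 (a b c : M L) : M3 := M.t a (M.t b c)

def mP010 (s : Bool) : M3 :=
  mt3 m1 m1 m1 - cg s 1 1 • mt3 mE (mK s) mF + cg s 1 (-1) • mt3 (mFK s) (mK s) (mEK s)
    + cg s 2 0 • mt3 (mEFK s) m1 (mEFK s)

def mP101 (s : Bool) : M3 :=
  cg s (-1) 1 • mt3 m1 mF (mEK s) + mt3 m1 (mK s) m1 + cg s 2 0 • mt3 m1 mEF (mEFK s)
    - cg s 1 1 • mt3 m1 (mEK s) mF - cg s 1 1 • mt3 mE (mFK s) m1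
    + cg s 0 2 • mt3 mE (mEFK s) mF + cg s 1 (-1) • mt3 (mFK s) mE m1
    - cg s 0 2 • mt3 (mFK s) (mEFK s) (mEK s) - cg s 2 0 • mt3 (mEFK s) mEF m1

def mP111 (s : Bool) : M3 :=
  (L.mul (ci s) (lI 0 1)) • (
    cg s 1 1 • mt3 m1 mF (mEK s) - mt3 m1 (mK s) m1 - cg s 2 0 • mt3 m1 mEF m1
      - cg s 0 2 • mt3 m1 mEF (mEFK s) + cg s 1 1 • mt3 m1 (mEK s) mF
      - cg s 1 1 • mt3 mE m1 mF + cg s 1 1 • mt3 mE (mFK s) m1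
      + cg s 0 2 • mt3 mE (mFK s) (mEFK s) + cg s 2 0 • mt3 mE (mEFK s) mF
      - cg s 1 1 • mt3 (mFK s) m1 (mEK s) + cg s 1 1 • mt3 (mFK s) mE m1
      + cg s 0 2 • mt3 (mFK s) mE (mEFK s) + cg s 2 0 • mt3 (mFK s) (mEFK s) (mEK s)
      + cg s 0 2 • mt3 (mEFK s) mF (mEK s) + cg s 0 2 • mt3 (mEFK s) (mK s) (mEFK s)
      - cg s 0 2 • mt3 (mEFK s) mEF m1 + cg s 0 2 • mt3 (mEFK s) (mEK s) mF
      + cg s 4 0 • mt3 (mEFK s) mEF (mEFK s))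

def mPhi (s : Bool) : M3 :=
  mt3 me0 me0 me0 + mt3 me1 me0 me0 + mP010 s * mt3 me0 me1 me0 + mt3 me0 me0 me1
    + mt3 me1 me1 me0 + mP101 s * mt3 me1 me0 me1 + mt3 me0 me1 me1 + mP111 s * mt3 me1 me1 me1

def mR00 (s : Bool) : M2 :=
  (mt2 m1 m1 + mt2 m1 (mK s) + mt2 (mK s) m1 - mt2 (mK s) (mK s)) *
    (mt2 m1 m1 + cg s 0 2 • mt2 mE mF)

def mR01 (s : Bool) : M2 :=
  (mt2 m1 m1 - ci s • mt2 m1 (mK s) + mt2 (mK s) m1 + ci s • mt2 (mK s) (mK s)) *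
    (mt2 m1 m1 + cg s 1 (-1) • mt2 (mFK s) (mEK s) - cg s 1 (-1) • mt2 mE mF
      + cg s 1 1 • mt2 (mEFK s) m1 + cg s 0 2 • mt2 (mEFK s) (mEFK s))

def mR10 (s : Bool) : M2 :=
  (mt2 m1 m1 + mt2 m1 (mK s) - ci s • mt2 (mK s) m1 + ci s • mt2 (mK s) (mK s)) *
    (mt2 m1 (mK s) + cg s 1 (-1) • mt2 (mFK s) mE + cg s 1 (-1) • mt2 mE (mFK s)
      - cg s 1 (-1) • mt2 m1 mEF - cg s 0 2 • mt2 (mEFK s) mEF)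

def mR11 (s : Bool) : M2 :=
  cB • ((mt2 m1 m1 - ci s • mt2 m1 (mK s) - ci s • mt2 (mK s) m1 + mt2 (mK s) (mK s)) *
    (cg s 0 (-1) • mt2 (mK s) m1 + cg s 0 2 • mt2 (mEK s) mF + cg s 1 (-1) • mt2 (mK s) (mEFK s)
      - cg s 1 1 • mt2 mEF m1 - cg s 0 2 • mt2 mEF (mEFK s)))

/-- Twice the R-matrix. -/
def mRR (s : Bool) : M2 :=
  mR00 s * mt2 me0 me0 + mR01 s * mt2 me0 me1 + mR10 s * mt2 me1 me0 + mR11 s * mt2 me1 me1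

/-- The R-matrix. -/
def mR (s : Bool) : M2 := M.map (M.map L.half) (mRR s)

/-- Inverse of the coassociator, from its minimal polynomial `(x - 1) ^ 2 (x ^ 4 - 1)`. -/
def mPhiI (s : Bool) : M3 :=
  let x := mPhi s
  let e := mt3 m1 m1 m1
  lI 2 0 • e + x * (x * (x * (e + x * (x - lI 2 0 • e))) - e)

/-- Inverse of the R-matrix, from its minimal polynomial. -/
def mRI (s : Bool) : M2 :=
  let x := mR s
  let e := mt2 m1 m1
  lI 0 (-1) • (lI 0 1 • e + x * (lI (-1) 2 • e + x * (lI 1 (-2) • e + x * (lI 2 (-2) • e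
    + x * (lI (-2) 2 • e + x * (lI (-2) 2 • e + x * (lI 2 (-2) • e + x * (lI 2 (-1) • e
    + x * (lI (-2) 1 • e + x * (lI (-1) 0 • e + x))))))))))

def dE (s : Bool) : M2 := mt2 m1 mE + mt2 mE (mK s)
def dF (s : Bool) : M2 := mt2 (mKi s) mF + mt2 mF m1
def dK (s : Bool) : M2 := mt2 (mK s) (mK s)
def d1 : M2 := mt2 m1 m1
def dw0 : M2 := mt2 mw0 mw0 + mt2 mw1 mw3 + mt2 mw2 mw2 + mt2 mw3 mw1
def dw1 : M2 := mt2 mw0 mw1 + mt2 mw1 mw0 + mt2 mw2 mw3 + mt2 mw3 mw2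
def dw2 : M2 := mt2 mw0 mw2 + mt2 mw1 mw1 + mt2 mw2 mw0 + mt2 mw3 mw3
def dw3 : M2 := mt2 mw0 mw3 + mt2 mw1 mw2 + mt2 mw2 mw1 + mt2 mw3 mw0

/-- Coproducts of the basis elements. -/
def dZ (s : Bool) : ℕ → M2
  | 0 => M.nrm (M.map M.nrm (dw0))
  | 1 => M.nrm (M.map M.nrm (dE s * (dF s * dw0)))
  | 2 => M.nrm (M.map M.nrm (dw2))
  | 3 => M.nrm (M.map M.nrm (dE s * (dF s * dw2)))
  | 4 => M.nrm (M.map M.nrm (dE s * (dF s * dw1)))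
  | 5 => M.nrm (M.map M.nrm (dE s * (dF s * dw3) + dw3))
  | 6 => M.nrm (M.map M.nrm (dw1 - dE s * (dF s * dw1)))
  | _ => M.nrm (M.map M.nrm (cN • (dE s * (dF s * dw3))))

def dP (s : Bool) : ℕ → M2
  | 0 => M.nrm (M.map M.nrm (dE s * dw0))
  | 1 => M.nrm (M.map M.nrm (dE s * dw2))
  | 2 => M.nrm (M.map M.nrm (dE s * dw3))
  | _ => M.nrm (M.map M.nrm (dE s * dw1))

def dM (s : Bool) : ℕ → M2
  | 0 => M.nrm (M.map M.nrm (dF s * dw0))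
  | 1 => M.nrm (M.map M.nrm (dF s * dw2))
  | 2 => M.nrm (M.map M.nrm (dF s * dw1))
  | _ => M.nrm (M.map M.nrm (cN • (dF s * dw3)))

def mcop {A : Type} [Ops A] (s : Bool) (x : M A) : M (M A) :=
  M.rec .o (fun c p m => M.add (Z8.rec .o (fun x0 x1 x2 x3 x4 x5 x6 x7 => (M.add (M.add (M.add (M.add (M.add (M.add (M.add (M.bind2 (dZ s 0) x0)
      (M.bind2 (dZ s 1) x1))
      (M.bind2 (dZ s 2) x2))
      (M.bind2 (dZ s 3) x3))
      (M.bind2 (dZ s 4) x4))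
      (M.bind2 (dZ s 5) x5))
      (M.bind2 (dZ s 6) x6))
      (M.bind2 (dZ s 7) x7))) c)
    (M.add (P4.rec .o (fun x0 x1 x2 x3 => (M.add (M.add (M.add (M.bind2 (dP s 0) x0)
      (M.bind2 (dP s 1) x1))
      (M.bind2 (dP s 2) x2))
      (M.bind2 (dP s 3) x3))) p)
      (P4.rec .o (fun x0 x1 x2 x3 => (M.add (M.add (M.add (M.bind2 (dM s 0) x0)
      (M.bind2 (dM s 1) x1))
      (M.bind2 (dM s 2) x2))
      (M.bind2 (dM s 3) x3))) m))) x

def eqc {A : Type} [Ops A] (x y : A) : Bool := Ops.isz (msub x y)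

def r13 (x : M2) : M3 := M.map (fun y => M.t m1 y) x
def r12 (x : M2) : M3 := M.map (M.map (fun c => Ops.smul c m1)) x
def r23 (x : M2) : M3 := M.t m1 x
def p132 (x : M3) : M3 := M.map M.swap x
def p213 (x : M3) : M3 := M.swap x
def p231 (x : M3) : M3 := M.map M.swap (M.swap x)
def p312 (x : M3) : M3 := M.swap (M.map M.swap x)


set_option linter.unusedSimpArgs false

/-! ### Relations -/

/-- An algebra with elements satisfying the relations of the restricted quantum group. -/
structure QD (A : Type) [Ring A] [Algebra ℂ A] where
  E : A
  F : A
  K : A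
  K4 : K ^ 4 = 1
  KE : K * E = -(E * K)
  KF : K * F = -(F * K)
  EE : E * E = 0
  FF : F * F = 0
  EF : E * F - F * E = (2 * Complex.I)⁻¹ • (K - K ^ 3)

theorem I3 : Complex.I ^ 3 = -Complex.I := by rw [pow_succ, Complex.I_sq]; ring
theorem I4 : Complex.I ^ 4 = 1 := by rw [pow_succ, I3, neg_mul, Complex.I_mul_I, neg_neg]
theorem In3 : (-Complex.I) ^ 3 = Complex.I := by
  rw [pow_succ, neg_sq, Complex.I_sq]; ring
theorem In4 : (-Complex.I) ^ 4 = 1 := by rw [pow_succ, In3, mul_neg, Complex.I_mul_I, neg_neg]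
theorem n4 : (-1 : ℂ) ^ 4 = 1 := by norm_num

namespace QD
variable {A : Type} [Ring A] [Algebra ℂ A] (D : QD A)

/-- Spectral projectors of `K`, up to normalisation of the eigenvalue. -/
def wv (c : ℂ) : A := (4:ℂ)⁻¹ • (1 + c • D.K + c ^ 2 • D.K ^ 2 + c ^ 3 • D.K ^ 3)

theorem K_wv (c : ℂ) (hc : c ^ 4 = 1) : D.K * D.wv c = c ^ 3 • D.wv c := by
  have h3 : D.K * D.K ^ 3 = 1 := by rw [← pow_succ', D.K4]
  have h2 : D.K * D.K ^ 2 = D.K ^ 3 := by rw [← pow_succ']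
  have h1 : D.K * D.K = D.K ^ 2 := by rw [pow_two]
  simp only [wv, mul_smul_comm, mul_add, mul_one, h1, h2, h3, smul_add, smul_smul]
  rw [show c ^ 3 * (4⁻¹ * c) = 4⁻¹ * c ^ 4 by ring,
    show c ^ 3 * (4⁻¹ * c ^ 2) = 4⁻¹ * (c ^ 4 * c) by ring,
    show c ^ 3 * (4⁻¹ * c ^ 3) = 4⁻¹ * (c ^ 4 * c ^ 2) by ring, hc]
  simp only [one_mul, mul_comm (4⁻¹ : ℂ)]
  abel

theorem wv_mul (c d e : ℂ) (hd : d ^ 4 = 1) (he : c * d ^ 3 = e) :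
    D.wv c * D.wv d = (4⁻¹ * (1 + e + e ^ 2 + e ^ 3)) • D.wv d := by
  have h1 := D.K_wv d hd
  have h2 : D.K ^ 2 * D.wv d = (d ^ 3 * d ^ 3) • D.wv d := by
    rw [pow_two, mul_assoc, h1, mul_smul_comm, h1, smul_smul]
  have h3 : D.K ^ 3 * D.wv d = (d ^ 3 * (d ^ 3 * d ^ 3)) • D.wv d := by
    rw [pow_succ, mul_assoc, h1, mul_smul_comm, h2, smul_smul]
  rw [show D.wv c = (4:ℂ)⁻¹ • (1 + c • D.K + c ^ 2 • D.K ^ 2 + c ^ 3 • D.K ^ 3) from rfl, ← he]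
  simp only [smul_mul_assoc, add_mul, one_mul, h1, h2, h3, smul_smul]
  module

theorem wv_E (c : ℂ) : D.wv c * D.E = D.E * D.wv (-c) := by
  have h2 : D.K ^ 2 * D.E = D.E * D.K ^ 2 := by
    rw [pow_two, mul_assoc, D.KE, mul_neg, ← mul_assoc, D.KE, neg_mul, neg_neg, mul_assoc]
  have h3 : D.K ^ 3 * D.E = -(D.E * D.K ^ 3) := by
    rw [pow_succ, mul_assoc, D.KE, mul_neg, ← mul_assoc, h2, mul_assoc]
  simp only [wv, smul_mul_assoc, mul_smul_comm, add_mul, mul_add, one_mul, mul_one, D.KE, h2, h3]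
  module

theorem wv_F (c : ℂ) : D.wv c * D.F = D.F * D.wv (-c) := by
  have h2 : D.K ^ 2 * D.F = D.F * D.K ^ 2 := by
    rw [pow_two, mul_assoc, D.KF, mul_neg, ← mul_assoc, D.KF, neg_mul, neg_neg, mul_assoc]
  have h3 : D.K ^ 3 * D.F = -(D.F * D.K ^ 3) := by
    rw [pow_succ, mul_assoc, D.KF, mul_neg, ← mul_assoc, h2, mul_assoc]
  simp only [wv, smul_mul_assoc, mul_smul_comm, add_mul, mul_add, one_mul, mul_one, D.KF, h2, h3]
  module

def w0 : A := D.wv 1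
def w1 : A := D.wv (-Complex.I)
def w2 : A := D.wv (-1)
def w3 : A := D.wv Complex.I

theorem w0w0 : D.w0 * D.w0 = D.w0 := by
  rw [w0, D.wv_mul _ _ 1 (one_pow 4) (by norm_num [I3, In3])]
  norm_num [I3, In3]
theorem w0w1 : D.w0 * D.w1 = 0 := by
  rw [w0, w1, D.wv_mul _ _ Complex.I In4 (by norm_num [I3, In3])]
  norm_num [I3, In3]
theorem w0w2 : D.w0 * D.w2 = 0 := by
  rw [w0, w2, D.wv_mul _ _ (-1) n4 (by norm_num [I3, In3])]
  norm_num [I3, In3]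
theorem w0w3 : D.w0 * D.w3 = 0 := by
  rw [w0, w3, D.wv_mul _ _ (-Complex.I) I4 (by norm_num [I3, In3])]
  norm_num [I3, In3]
theorem w1w0 : D.w1 * D.w0 = 0 := by
  rw [w1, w0, D.wv_mul _ _ (-Complex.I) (one_pow 4) (by norm_num [I3, In3])]
  norm_num [I3, In3]
theorem w1w1 : D.w1 * D.w1 = D.w1 := by
  rw [w1, D.wv_mul _ _ 1 In4 (by norm_num [I3, In3])]
  norm_num [I3, In3]
theorem w1w2 : D.w1 * D.w2 = 0 := by
  rw [w1, w2, D.wv_mul _ _ Complex.I n4 (by norm_num [I3, In3])]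
  norm_num [I3, In3]
theorem w1w3 : D.w1 * D.w3 = 0 := by
  rw [w1, w3, D.wv_mul _ _ (-1) I4 (by norm_num [I3, In3])]
  norm_num [I3, In3]
theorem w2w0 : D.w2 * D.w0 = 0 := by
  rw [w2, w0, D.wv_mul _ _ (-1) (one_pow 4) (by norm_num [I3, In3])]
  norm_num [I3, In3]
theorem w2w1 : D.w2 * D.w1 = 0 := by
  rw [w2, w1, D.wv_mul _ _ (-Complex.I) In4 (by norm_num [I3, In3])]
  norm_num [I3, In3]
theorem w2w2 : D.w2 * D.w2 = D.w2 := by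
  rw [w2, D.wv_mul _ _ 1 n4 (by norm_num [I3, In3])]
  norm_num [I3, In3]
theorem w2w3 : D.w2 * D.w3 = 0 := by
  rw [w2, w3, D.wv_mul _ _ Complex.I I4 (by norm_num [I3, In3])]
  norm_num [I3, In3]
theorem w3w0 : D.w3 * D.w0 = 0 := by
  rw [w3, w0, D.wv_mul _ _ Complex.I (one_pow 4) (by norm_num [I3, In3])]
  norm_num [I3, In3]
theorem w3w1 : D.w3 * D.w1 = 0 := by
  rw [w3, w1, D.wv_mul _ _ (-1) In4 (by norm_num [I3, In3])]
  norm_num [I3, In3]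
theorem w3w2 : D.w3 * D.w2 = 0 := by
  rw [w3, w2, D.wv_mul _ _ (-Complex.I) n4 (by norm_num [I3, In3])]
  norm_num [I3, In3]
theorem w3w3 : D.w3 * D.w3 = D.w3 := by
  rw [w3, D.wv_mul _ _ 1 I4 (by norm_num [I3, In3])]
  norm_num [I3, In3]
theorem w0E : D.w0 * D.E = D.E * D.w2 := by
  rw [w0, w2, D.wv_E]
theorem w1E : D.w1 * D.E = D.E * D.w3 := by
  rw [w1, w3, D.wv_E, neg_neg]
theorem w2E : D.w2 * D.E = D.E * D.w0 := by
  rw [w2, w0, D.wv_E, neg_neg]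
theorem w3E : D.w3 * D.E = D.E * D.w1 := by
  rw [w3, w1, D.wv_E]
theorem w0F : D.w0 * D.F = D.F * D.w2 := by
  rw [w0, w2, D.wv_F]
theorem w1F : D.w1 * D.F = D.F * D.w3 := by
  rw [w1, w3, D.wv_F, neg_neg]
theorem w2F : D.w2 * D.F = D.F * D.w0 := by
  rw [w2, w0, D.wv_F, neg_neg]
theorem w3F : D.w3 * D.F = D.F * D.w1 := by
  rw [w3, w1, D.wv_F]

theorem wsum : D.w0 + D.w1 + D.w2 + D.w3 = 1 := by
  simp only [w0, w1, w2, w3, wv, I3, In3, neg_sq, Complex.I_sq]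
  module
theorem Kw : D.K = D.w0 + Complex.I • D.w1 - D.w2 - Complex.I • D.w3 := by
  have h : D.K * (D.w0 + D.w1 + D.w2 + D.w3) = D.K := by rw [wsum, mul_one]
  rw [← h]
  simp only [mul_add, w0, w1, w2, w3, D.K_wv _ (one_pow 4), D.K_wv _ In4, D.K_wv _ n4,
    D.K_wv _ I4, I3, In3]
  module
theorem K3w : D.K ^ 3 = D.w0 - Complex.I • D.w1 - D.w2 + Complex.I • D.w3 := by
  have h : D.K * (D.K * (D.K * (D.w0 + D.w1 + D.w2 + D.w3))) = D.K ^ 3 := by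
    rw [wsum, mul_one, pow_succ, pow_two, mul_assoc]
  rw [← h]
  simp only [mul_add, mul_smul_comm, w0, w1, w2, w3, D.K_wv _ (one_pow 4), D.K_wv _ In4,
    D.K_wv _ n4, D.K_wv _ I4, I3, In3, smul_smul, Complex.I_mul_I, mul_neg, neg_mul]
  module
theorem FE : D.F * D.E = D.E * D.F - D.w1 + D.w3 := by
  have h : (2 * Complex.I)⁻¹ • (D.K - D.K ^ 3) = D.w1 - D.w3 := by
    rw [K3w, Kw, inv_smul_eq_iff₀ (by simp)]
    module
  have h2 := D.EF
  rw [h, sub_eq_iff_eq_add] at h2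
  rw [h2]
  abel

theorem w0Ex (x : A) : D.w0 * (D.E * x) = D.E * (D.w2 * x) := by
  rw [← mul_assoc, w0E, mul_assoc]
theorem w0Fx (x : A) : D.w0 * (D.F * x) = D.F * (D.w2 * x) := by
  rw [← mul_assoc, w0F, mul_assoc]
theorem w1Ex (x : A) : D.w1 * (D.E * x) = D.E * (D.w3 * x) := by
  rw [← mul_assoc, w1E, mul_assoc]
theorem w1Fx (x : A) : D.w1 * (D.F * x) = D.F * (D.w3 * x) := by
  rw [← mul_assoc, w1F, mul_assoc]
theorem w2Ex (x : A) : D.w2 * (D.E * x) = D.E * (D.w0 * x) := by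
  rw [← mul_assoc, w2E, mul_assoc]
theorem w2Fx (x : A) : D.w2 * (D.F * x) = D.F * (D.w0 * x) := by
  rw [← mul_assoc, w2F, mul_assoc]
theorem w3Ex (x : A) : D.w3 * (D.E * x) = D.E * (D.w1 * x) := by
  rw [← mul_assoc, w3E, mul_assoc]
theorem w3Fx (x : A) : D.w3 * (D.F * x) = D.F * (D.w1 * x) := by
  rw [← mul_assoc, w3F, mul_assoc]
theorem EEx (x : A) : D.E * (D.E * x) = 0 := by rw [← mul_assoc, D.EE, zero_mul]
theorem FFx (x : A) : D.F * (D.F * x) = 0 := by rw [← mul_assoc, D.FF, zero_mul]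
theorem FEx (x : A) : D.F * (D.E * x) = D.E * (D.F * x) - D.w1 * x + D.w3 * x := by
  rw [← mul_assoc, D.FE, add_mul, sub_mul, mul_assoc]

def z0 : A := D.w0
def z1 : A := D.E * (D.F * D.w0)
def z2 : A := D.w2
def z3 : A := D.E * (D.F * D.w2)
def z4 : A := D.E * (D.F * D.w1)
def z5 : A := D.E * (D.F * D.w3) + D.w3
def z6 : A := D.w1 - D.E * (D.F * D.w1)
def z7 : A := -(D.E * (D.F * D.w3))
def p0 : A := D.E * D.w0
def p1 : A := D.E * D.w2
def p2 : A := D.E * D.w3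
def p3 : A := D.E * D.w1
def n0 : A := D.F * D.w0
def n1 : A := D.F * D.w2
def n2 : A := D.F * D.w1
def n3 : A := -(D.F * D.w3)

theorem tzz : D.z0 * D.z0 = D.z0 ∧ D.z0 * D.z1 = D.z1 ∧ D.z0 * D.z2 = 0 ∧ D.z0 * D.z3 = 0 ∧
    D.z0 * D.z4 = 0 ∧ D.z0 * D.z5 = 0 ∧ D.z0 * D.z6 = 0 ∧ D.z0 * D.z7 = 0 ∧
    D.z1 * D.z0 = D.z1 ∧ D.z1 * D.z1 = 0 ∧ D.z1 * D.z2 = 0 ∧ D.z1 * D.z3 = 0 ∧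
    D.z1 * D.z4 = 0 ∧ D.z1 * D.z5 = 0 ∧ D.z1 * D.z6 = 0 ∧ D.z1 * D.z7 = 0 ∧
    D.z2 * D.z0 = 0 ∧ D.z2 * D.z1 = 0 ∧ D.z2 * D.z2 = D.z2 ∧ D.z2 * D.z3 = D.z3 ∧
    D.z2 * D.z4 = 0 ∧ D.z2 * D.z5 = 0 ∧ D.z2 * D.z6 = 0 ∧ D.z2 * D.z7 = 0 ∧
    D.z3 * D.z0 = 0 ∧ D.z3 * D.z1 = 0 ∧ D.z3 * D.z2 = D.z3 ∧ D.z3 * D.z3 = 0 ∧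
    D.z3 * D.z4 = 0 ∧ D.z3 * D.z5 = 0 ∧ D.z3 * D.z6 = 0 ∧ D.z3 * D.z7 = 0 ∧
    D.z4 * D.z0 = 0 ∧ D.z4 * D.z1 = 0 ∧ D.z4 * D.z2 = 0 ∧ D.z4 * D.z3 = 0 ∧
    D.z4 * D.z4 = D.z4 ∧ D.z4 * D.z5 = 0 ∧ D.z4 * D.z6 = 0 ∧ D.z4 * D.z7 = 0 ∧
    D.z5 * D.z0 = 0 ∧ D.z5 * D.z1 = 0 ∧ D.z5 * D.z2 = 0 ∧ D.z5 * D.z3 = 0 ∧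
    D.z5 * D.z4 = 0 ∧ D.z5 * D.z5 = D.z5 ∧ D.z5 * D.z6 = 0 ∧ D.z5 * D.z7 = 0 ∧
    D.z6 * D.z0 = 0 ∧ D.z6 * D.z1 = 0 ∧ D.z6 * D.z2 = 0 ∧ D.z6 * D.z3 = 0 ∧
    D.z6 * D.z4 = 0 ∧ D.z6 * D.z5 = 0 ∧ D.z6 * D.z6 = D.z6 ∧ D.z6 * D.z7 = 0 ∧
    D.z7 * D.z0 = 0 ∧ D.z7 * D.z1 = 0 ∧ D.z7 * D.z2 = 0 ∧ D.z7 * D.z3 = 0 ∧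
    D.z7 * D.z4 = 0 ∧ D.z7 * D.z5 = 0 ∧ D.z7 * D.z6 = 0 ∧ D.z7 * D.z7 = D.z7 := by
  and_intros <;> (simp only [z0, z1, z2, z3, z4, z5, z6, z7, p0, p1, p2, p3, n0, n1, n2, n3, mul_assoc, mul_add, add_mul, mul_sub, sub_mul,
    mul_neg, neg_mul, mul_zero, zero_mul, sub_zero, zero_sub, add_zero, zero_add, neg_zero, neg_neg,
    neg_add_rev, neg_sub, D.w0Ex, D.w0Fx, D.w0w0, D.w0w1, D.w0w2, D.w0w3, D.w1Ex, D.w1Fx, D.w1w0, D.w1w1, D.w1w2, D.w1w3,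
    D.w2Ex, D.w2Fx, D.w2w0, D.w2w1, D.w2w2, D.w2w3, D.w3Ex, D.w3Fx, D.w3w0, D.w3w1, D.w3w2, D.w3w3, D.EEx, D.FFx, D.FEx] <;> try abel)

theorem tzp : D.z0 * D.p0 = 0 ∧ D.z0 * D.p1 = D.p1 ∧ D.z0 * D.p2 = 0 ∧ D.z0 * D.p3 = 0 ∧
    D.z1 * D.p0 = 0 ∧ D.z1 * D.p1 = 0 ∧ D.z1 * D.p2 = 0 ∧ D.z1 * D.p3 = 0 ∧
    D.z2 * D.p0 = D.p0 ∧ D.z2 * D.p1 = 0 ∧ D.z2 * D.p2 = 0 ∧ D.z2 * D.p3 = 0 ∧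
    D.z3 * D.p0 = 0 ∧ D.z3 * D.p1 = 0 ∧ D.z3 * D.p2 = 0 ∧ D.z3 * D.p3 = 0 ∧
    D.z4 * D.p0 = 0 ∧ D.z4 * D.p1 = 0 ∧ D.z4 * D.p2 = D.p2 ∧ D.z4 * D.p3 = 0 ∧
    D.z5 * D.p0 = 0 ∧ D.z5 * D.p1 = 0 ∧ D.z5 * D.p2 = 0 ∧ D.z5 * D.p3 = 0 ∧
    D.z6 * D.p0 = 0 ∧ D.z6 * D.p1 = 0 ∧ D.z6 * D.p2 = 0 ∧ D.z6 * D.p3 = 0 ∧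
    D.z7 * D.p0 = 0 ∧ D.z7 * D.p1 = 0 ∧ D.z7 * D.p2 = 0 ∧ D.z7 * D.p3 = D.p3 := by
  and_intros <;> (simp only [z0, z1, z2, z3, z4, z5, z6, z7, p0, p1, p2, p3, n0, n1, n2, n3, mul_assoc, mul_add, add_mul, mul_sub, sub_mul,
    mul_neg, neg_mul, mul_zero, zero_mul, sub_zero, zero_sub, add_zero, zero_add, neg_zero, neg_neg,
    neg_add_rev, neg_sub, D.w0Ex, D.w0Fx, D.w0w0, D.w0w1, D.w0w2, D.w0w3, D.w1Ex, D.w1Fx, D.w1w0, D.w1w1, D.w1w2, D.w1w3,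
    D.w2Ex, D.w2Fx, D.w2w0, D.w2w1, D.w2w2, D.w2w3, D.w3Ex, D.w3Fx, D.w3w0, D.w3w1, D.w3w2, D.w3w3, D.EEx, D.FFx, D.FEx] <;> try abel)

theorem tzn : D.z0 * D.n0 = 0 ∧ D.z0 * D.n1 = D.n1 ∧ D.z0 * D.n2 = 0 ∧ D.z0 * D.n3 = 0 ∧
    D.z1 * D.n0 = 0 ∧ D.z1 * D.n1 = 0 ∧ D.z1 * D.n2 = 0 ∧ D.z1 * D.n3 = 0 ∧
    D.z2 * D.n0 = D.n0 ∧ D.z2 * D.n1 = 0 ∧ D.z2 * D.n2 = 0 ∧ D.z2 * D.n3 = 0 ∧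
    D.z3 * D.n0 = 0 ∧ D.z3 * D.n1 = 0 ∧ D.z3 * D.n2 = 0 ∧ D.z3 * D.n3 = 0 ∧
    D.z4 * D.n0 = 0 ∧ D.z4 * D.n1 = 0 ∧ D.z4 * D.n2 = 0 ∧ D.z4 * D.n3 = 0 ∧
    D.z5 * D.n0 = 0 ∧ D.z5 * D.n1 = 0 ∧ D.z5 * D.n2 = D.n2 ∧ D.z5 * D.n3 = 0 ∧
    D.z6 * D.n0 = 0 ∧ D.z6 * D.n1 = 0 ∧ D.z6 * D.n2 = 0 ∧ D.z6 * D.n3 = D.n3 ∧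
    D.z7 * D.n0 = 0 ∧ D.z7 * D.n1 = 0 ∧ D.z7 * D.n2 = 0 ∧ D.z7 * D.n3 = 0 := by
  and_intros <;> (simp only [z0, z1, z2, z3, z4, z5, z6, z7, p0, p1, p2, p3, n0, n1, n2, n3, mul_assoc, mul_add, add_mul, mul_sub, sub_mul,
    mul_neg, neg_mul, mul_zero, zero_mul, sub_zero, zero_sub, add_zero, zero_add, neg_zero, neg_neg,
    neg_add_rev, neg_sub, D.w0Ex, D.w0Fx, D.w0w0, D.w0w1, D.w0w2, D.w0w3, D.w1Ex, D.w1Fx, D.w1w0, D.w1w1, D.w1w2, D.w1w3,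
    D.w2Ex, D.w2Fx, D.w2w0, D.w2w1, D.w2w2, D.w2w3, D.w3Ex, D.w3Fx, D.w3w0, D.w3w1, D.w3w2, D.w3w3, D.EEx, D.FFx, D.FEx] <;> try abel)

theorem tpz : D.p0 * D.z0 = D.p0 ∧ D.p0 * D.z1 = 0 ∧ D.p0 * D.z2 = 0 ∧ D.p0 * D.z3 = 0 ∧
    D.p0 * D.z4 = 0 ∧ D.p0 * D.z5 = 0 ∧ D.p0 * D.z6 = 0 ∧ D.p0 * D.z7 = 0 ∧
    D.p1 * D.z0 = 0 ∧ D.p1 * D.z1 = 0 ∧ D.p1 * D.z2 = D.p1 ∧ D.p1 * D.z3 = 0 ∧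
    D.p1 * D.z4 = 0 ∧ D.p1 * D.z5 = 0 ∧ D.p1 * D.z6 = 0 ∧ D.p1 * D.z7 = 0 ∧
    D.p2 * D.z0 = 0 ∧ D.p2 * D.z1 = 0 ∧ D.p2 * D.z2 = 0 ∧ D.p2 * D.z3 = 0 ∧
    D.p2 * D.z4 = 0 ∧ D.p2 * D.z5 = D.p2 ∧ D.p2 * D.z6 = 0 ∧ D.p2 * D.z7 = 0 ∧
    D.p3 * D.z0 = 0 ∧ D.p3 * D.z1 = 0 ∧ D.p3 * D.z2 = 0 ∧ D.p3 * D.z3 = 0 ∧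
    D.p3 * D.z4 = 0 ∧ D.p3 * D.z5 = 0 ∧ D.p3 * D.z6 = D.p3 ∧ D.p3 * D.z7 = 0 := by
  and_intros <;> (simp only [z0, z1, z2, z3, z4, z5, z6, z7, p0, p1, p2, p3, n0, n1, n2, n3, mul_assoc, mul_add, add_mul, mul_sub, sub_mul,
    mul_neg, neg_mul, mul_zero, zero_mul, sub_zero, zero_sub, add_zero, zero_add, neg_zero, neg_neg,
    neg_add_rev, neg_sub, D.w0Ex, D.w0Fx, D.w0w0, D.w0w1, D.w0w2, D.w0w3, D.w1Ex, D.w1Fx, D.w1w0, D.w1w1, D.w1w2, D.w1w3,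
    D.w2Ex, D.w2Fx, D.w2w0, D.w2w1, D.w2w2, D.w2w3, D.w3Ex, D.w3Fx, D.w3w0, D.w3w1, D.w3w2, D.w3w3, D.EEx, D.FFx, D.FEx] <;> try abel)

theorem tpp : D.p0 * D.p0 = 0 ∧ D.p0 * D.p1 = 0 ∧ D.p0 * D.p2 = 0 ∧ D.p0 * D.p3 = 0 ∧
    D.p1 * D.p0 = 0 ∧ D.p1 * D.p1 = 0 ∧ D.p1 * D.p2 = 0 ∧ D.p1 * D.p3 = 0 ∧
    D.p2 * D.p0 = 0 ∧ D.p2 * D.p1 = 0 ∧ D.p2 * D.p2 = 0 ∧ D.p2 * D.p3 = 0 ∧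
    D.p3 * D.p0 = 0 ∧ D.p3 * D.p1 = 0 ∧ D.p3 * D.p2 = 0 ∧ D.p3 * D.p3 = 0 := by
  and_intros <;> (simp only [z0, z1, z2, z3, z4, z5, z6, z7, p0, p1, p2, p3, n0, n1, n2, n3, mul_assoc, mul_add, add_mul, mul_sub, sub_mul,
    mul_neg, neg_mul, mul_zero, zero_mul, sub_zero, zero_sub, add_zero, zero_add, neg_zero, neg_neg,
    neg_add_rev, neg_sub, D.w0Ex, D.w0Fx, D.w0w0, D.w0w1, D.w0w2, D.w0w3, D.w1Ex, D.w1Fx, D.w1w0, D.w1w1, D.w1w2, D.w1w3,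
    D.w2Ex, D.w2Fx, D.w2w0, D.w2w1, D.w2w2, D.w2w3, D.w3Ex, D.w3Fx, D.w3w0, D.w3w1, D.w3w2, D.w3w3, D.EEx, D.FFx, D.FEx] <;> try abel)

theorem tpn : D.p0 * D.n0 = 0 ∧ D.p0 * D.n1 = D.z3 ∧ D.p0 * D.n2 = 0 ∧ D.p0 * D.n3 = 0 ∧
    D.p1 * D.n0 = D.z1 ∧ D.p1 * D.n1 = 0 ∧ D.p1 * D.n2 = 0 ∧ D.p1 * D.n3 = 0 ∧
    D.p2 * D.n0 = 0 ∧ D.p2 * D.n1 = 0 ∧ D.p2 * D.n2 = D.z4 ∧ D.p2 * D.n3 = 0 ∧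
    D.p3 * D.n0 = 0 ∧ D.p3 * D.n1 = 0 ∧ D.p3 * D.n2 = 0 ∧ D.p3 * D.n3 = D.z7 := by
  and_intros <;> (simp only [z0, z1, z2, z3, z4, z5, z6, z7, p0, p1, p2, p3, n0, n1, n2, n3, mul_assoc, mul_add, add_mul, mul_sub, sub_mul,
    mul_neg, neg_mul, mul_zero, zero_mul, sub_zero, zero_sub, add_zero, zero_add, neg_zero, neg_neg,
    neg_add_rev, neg_sub, D.w0Ex, D.w0Fx, D.w0w0, D.w0w1, D.w0w2, D.w0w3, D.w1Ex, D.w1Fx, D.w1w0, D.w1w1, D.w1w2, D.w1w3,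
    D.w2Ex, D.w2Fx, D.w2w0, D.w2w1, D.w2w2, D.w2w3, D.w3Ex, D.w3Fx, D.w3w0, D.w3w1, D.w3w2, D.w3w3, D.EEx, D.FFx, D.FEx] <;> try abel)

theorem tnz : D.n0 * D.z0 = D.n0 ∧ D.n0 * D.z1 = 0 ∧ D.n0 * D.z2 = 0 ∧ D.n0 * D.z3 = 0 ∧
    D.n0 * D.z4 = 0 ∧ D.n0 * D.z5 = 0 ∧ D.n0 * D.z6 = 0 ∧ D.n0 * D.z7 = 0 ∧
    D.n1 * D.z0 = 0 ∧ D.n1 * D.z1 = 0 ∧ D.n1 * D.z2 = D.n1 ∧ D.n1 * D.z3 = 0 ∧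
    D.n1 * D.z4 = 0 ∧ D.n1 * D.z5 = 0 ∧ D.n1 * D.z6 = 0 ∧ D.n1 * D.z7 = 0 ∧
    D.n2 * D.z0 = 0 ∧ D.n2 * D.z1 = 0 ∧ D.n2 * D.z2 = 0 ∧ D.n2 * D.z3 = 0 ∧
    D.n2 * D.z4 = D.n2 ∧ D.n2 * D.z5 = 0 ∧ D.n2 * D.z6 = 0 ∧ D.n2 * D.z7 = 0 ∧
    D.n3 * D.z0 = 0 ∧ D.n3 * D.z1 = 0 ∧ D.n3 * D.z2 = 0 ∧ D.n3 * D.z3 = 0 ∧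
    D.n3 * D.z4 = 0 ∧ D.n3 * D.z5 = 0 ∧ D.n3 * D.z6 = 0 ∧ D.n3 * D.z7 = D.n3 := by
  and_intros <;> (simp only [z0, z1, z2, z3, z4, z5, z6, z7, p0, p1, p2, p3, n0, n1, n2, n3, mul_assoc, mul_add, add_mul, mul_sub, sub_mul,
    mul_neg, neg_mul, mul_zero, zero_mul, sub_zero, zero_sub, add_zero, zero_add, neg_zero, neg_neg,
    neg_add_rev, neg_sub, D.w0Ex, D.w0Fx, D.w0w0, D.w0w1, D.w0w2, D.w0w3, D.w1Ex, D.w1Fx, D.w1w0, D.w1w1, D.w1w2, D.w1w3,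
    D.w2Ex, D.w2Fx, D.w2w0, D.w2w1, D.w2w2, D.w2w3, D.w3Ex, D.w3Fx, D.w3w0, D.w3w1, D.w3w2, D.w3w3, D.EEx, D.FFx, D.FEx] <;> try abel)

theorem tnp : D.n0 * D.p0 = 0 ∧ D.n0 * D.p1 = D.z3 ∧ D.n0 * D.p2 = 0 ∧ D.n0 * D.p3 = 0 ∧
    D.n1 * D.p0 = D.z1 ∧ D.n1 * D.p1 = 0 ∧ D.n1 * D.p2 = 0 ∧ D.n1 * D.p3 = 0 ∧
    D.n2 * D.p0 = 0 ∧ D.n2 * D.p1 = 0 ∧ D.n2 * D.p2 = D.z5 ∧ D.n2 * D.p3 = 0 ∧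
    D.n3 * D.p0 = 0 ∧ D.n3 * D.p1 = 0 ∧ D.n3 * D.p2 = 0 ∧ D.n3 * D.p3 = D.z6 := by
  and_intros <;> (simp only [z0, z1, z2, z3, z4, z5, z6, z7, p0, p1, p2, p3, n0, n1, n2, n3, mul_assoc, mul_add, add_mul, mul_sub, sub_mul,
    mul_neg, neg_mul, mul_zero, zero_mul, sub_zero, zero_sub, add_zero, zero_add, neg_zero, neg_neg,
    neg_add_rev, neg_sub, D.w0Ex, D.w0Fx, D.w0w0, D.w0w1, D.w0w2, D.w0w3, D.w1Ex, D.w1Fx, D.w1w0, D.w1w1, D.w1w2, D.w1w3,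
    D.w2Ex, D.w2Fx, D.w2w0, D.w2w1, D.w2w2, D.w2w3, D.w3Ex, D.w3Fx, D.w3w0, D.w3w1, D.w3w2, D.w3w3, D.EEx, D.FFx, D.FEx] <;> try abel)

theorem tnn : D.n0 * D.n0 = 0 ∧ D.n0 * D.n1 = 0 ∧ D.n0 * D.n2 = 0 ∧ D.n0 * D.n3 = 0 ∧
    D.n1 * D.n0 = 0 ∧ D.n1 * D.n1 = 0 ∧ D.n1 * D.n2 = 0 ∧ D.n1 * D.n3 = 0 ∧
    D.n2 * D.n0 = 0 ∧ D.n2 * D.n1 = 0 ∧ D.n2 * D.n2 = 0 ∧ D.n2 * D.n3 = 0 ∧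
    D.n3 * D.n0 = 0 ∧ D.n3 * D.n1 = 0 ∧ D.n3 * D.n2 = 0 ∧ D.n3 * D.n3 = 0 := by
  and_intros <;> (simp only [z0, z1, z2, z3, z4, z5, z6, z7, p0, p1, p2, p3, n0, n1, n2, n3, mul_assoc, mul_add, add_mul, mul_sub, sub_mul,
    mul_neg, neg_mul, mul_zero, zero_mul, sub_zero, zero_sub, add_zero, zero_add, neg_zero, neg_neg,
    neg_add_rev, neg_sub, D.w0Ex, D.w0Fx, D.w0w0, D.w0w1, D.w0w2, D.w0w3, D.w1Ex, D.w1Fx, D.w1w0, D.w1w1, D.w1w2, D.w1w3,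
    D.w2Ex, D.w2Fx, D.w2w0, D.w2w1, D.w2w2, D.w2w3, D.w3Ex, D.w3Fx, D.w3w0, D.w3w1, D.w3w2, D.w3w3, D.EEx, D.FFx, D.FEx] <;> try abel)

end QD

set_option linter.unusedSimpArgs false
set_option linter.unusedTactic false
set_option linter.unreachableTactic false
/-! ### Evaluation of the model -/

def evG (j : ℂ) : G → ℂ
  | .o => 0
  | .r a => a
  | .i b => b * j
  | .c a b => a + b * j

def evL (β : ℂ) : L → ℂ
  | .o => 0
  | .e x => evG (β ^ 2) x
  | .d y => evG (β ^ 2) y * β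
  | .c x y => evG (β ^ 2) x + evG (β ^ 2) y * β

/-- Compatibility of an evaluation map with the operations of the model. -/
structure Snd {A T : Type} [Ops A] [Ring T] [Algebra ℂ T] (l : L → ℂ) (ev : A → T) : Prop where
  zero : ev Ops.zero = 0
  add : ∀ x y, ev (Ops.add x y) = ev x + ev y
  smul : ∀ c x, ev (Ops.smul c x) = l c • ev x
  mul : ∀ x y, ev (Ops.mul x y) = ev x * ev y
  nul : ∀ x, Ops.nul x = true → ev x = 0
  isz : ∀ x, Ops.isz x = true → ev x = 0

theorem isz0_eq (a : Int) (h : isz0 a = true) : a = 0 := by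
  cases a with
  | ofNat n => exact congrArg Int.ofNat (Nat.eq_of_beq_eq_true h)
  | negSucc n => exact absurd h (by simp [isz0])

theorem evG_mr (j : ℂ) (a : Int) : evG j (G.mr a) = a := by
  unfold G.mr
  cases h : isz0 a with
  | true => rw [isz0_eq a h]; simp [evG]
  | false => rfl

theorem evG_mi (j : ℂ) (a : Int) : evG j (G.mi a) = a * j := by
  unfold G.mi
  cases h : isz0 a with
  | true => rw [isz0_eq a h]; simp [evG]
  | false => rfl

theorem evG_mk (j : ℂ) (a b : Int) : evG j (G.mk a b) = a + b * j := by
  unfold G.mk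
  cases h : isz0 a with
  | true => rw [isz0_eq a h]; simp [evG_mi]
  | false =>
    cases h' : isz0 b with
    | true => rw [isz0_eq b h']; simp [evG]
    | false => rfl

theorem evG_o (j : ℂ) : evG j .o = 0 := rfl
theorem evG_r (j : ℂ) (a : Int) : evG j (.r a) = a := rfl
theorem evG_i (j : ℂ) (a : Int) : evG j (.i a) = a * j := rfl
theorem evG_c (j : ℂ) (a b : Int) : evG j (.c a b) = a + b * j := rfl
theorem evL_o (β : ℂ) : evL β .o = 0 := rfl
theorem evL_e (β : ℂ) (x : G) : evL β (.e x) = evG (β ^ 2) x := rfl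
theorem evL_d (β : ℂ) (x : G) : evL β (.d x) = evG (β ^ 2) x * β := rfl
theorem evL_c (β : ℂ) (x y : G) : evL β (.c x y) = evG (β ^ 2) x + evG (β ^ 2) y * β := rfl

theorem ca (a b : Int) : ((Int.add a b : Int) : ℂ) = a + b := Int.cast_add a b
theorem cm (a b : Int) : ((Int.mul a b : Int) : ℂ) = a * b := Int.cast_mul a b
theorem cn (a : Int) : ((Int.neg a : Int) : ℂ) = - a := Int.cast_neg a

theorem evG_add (j : ℂ) (x y : G) : evG j (G.add x y) = evG j x + evG j y := by
  cases x <;> cases y <;> simp only [G.add, evG_mr, evG_mi, evG_mk, evG_o, evG_r, evG_i, evG_c, ca] <;> ring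

theorem evG_mul (j : ℂ) (hj : j ^ 2 = -1) (x y : G) : evG j (G.mul x y) = evG j x * evG j y := by
  cases x <;> cases y <;> simp only [G.mul, evG_mk, evG_o, evG_r, evG_i, evG_c, ca, cm, cn] <;>
    first | ring1 | (ring_nf; simp only [hj]; ring)

theorem evG_jm (j : ℂ) (hj : j ^ 2 = -1) (x : G) : evG j (G.jm x) = j * evG j x := by
  cases x <;> simp only [G.jm, evG_o, evG_r, evG_i, evG_c, cn] <;>
    first | ring1 | (ring_nf; simp only [hj]; ring)

theorem evG_isz (j : ℂ) (x : G) (h : G.isz x = true) : evG j x = 0 := by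
  cases x with
  | o => rfl
  | r a => simp [evG, isz0_eq a h]
  | i a => simp [evG, isz0_eq a h]
  | c a b =>
    have h' : (isz0 a && isz0 b) = true := h
    rw [Bool.and_eq_true] at h'
    simp [evG, isz0_eq a h'.1, isz0_eq b h'.2]

theorem evG_nul (j : ℂ) (x : G) (h : G.nul x = true) : evG j x = 0 := by
  cases x with
  | o => rfl
  | r a => exact absurd h (by simp [G.nul])
  | i a => exact absurd h (by simp [G.nul])
  | c a b => exact absurd h (by simp [G.nul])

section
variable (β : ℂ)

theorem evL_me (x : G) : evL β (L.me x) = evG (β ^ 2) x := by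
  unfold L.me
  cases h : G.nul x with
  | true => rw [evG_nul _ x h]; rfl
  | false => rfl

theorem evL_md (x : G) : evL β (L.md x) = evG (β ^ 2) x * β := by
  unfold L.md
  cases h : G.nul x with
  | true => rw [evG_nul _ x h, zero_mul]; rfl
  | false => rfl

theorem evL_mk (x y : G) : evL β (L.mk x y) = evG (β ^ 2) x + evG (β ^ 2) y * β := by
  unfold L.mk
  cases h : G.nul x with
  | true => simp [evG_nul _ x h, evL_md]
  | false =>
    cases h' : G.nul y with
    | true => simp [evG_nul _ y h', evL]
    | false => rfl

theorem sndL (hβ : β ^ 4 = -1) : Snd (evL β) (evL β) := by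
  have hj : (β ^ 2) ^ 2 = -1 := by rw [← pow_mul]; exact hβ
  have hm : ∀ x y, evL β (L.mul x y) = evL β x * evL β y := by
    intro x y
    cases x <;> cases y <;>
      simp only [L.mul, evL_mk, evL_o, evL_e, evL_d, evL_c, evG_add, evG_mul _ hj, evG_jm _ hj] <;> ring
  refine ⟨rfl, ?_, hm, hm, ?_, ?_⟩
  · intro x y
    change evL β (L.add x y) = _
    cases x <;> cases y <;> simp only [L.add, evL_me, evL_md, evL_mk, evL_o, evL_e, evL_d, evL_c,
      evG_add] <;> ring
  · intro x h
    cases x with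
    | o => rfl
    | e a => exact absurd h (by simp [Ops.nul, L.nul])
    | d a => exact absurd h (by simp [Ops.nul, L.nul])
    | c a b => exact absurd h (by simp [Ops.nul, L.nul])
  · intro x h
    cases x with
    | o => rfl
    | e a => exact evG_isz _ a h
    | d a => simp [evL, evG_isz _ a h]
    | c a b =>
      have h' : (G.isz a && G.isz b) = true := h
      rw [Bool.and_eq_true] at h'
      simp [evL, evG_isz _ a h'.1, evG_isz _ b h'.2]

end

namespace QD
section
variable {Q : Type} [Ring Q] [Algebra ℂ Q] (D : QD Q)
variable {A S T : Type} [Ring S] [Algebra ℂ S] [Ring T] [Algebra ℂ T]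
variable (f : Q →ₗ[ℂ] S →ₗ[ℂ] T) (ev : A → S)

def evZ : Z8 A → T
  | .o => 0
  | .n x0 x1 x2 x3 x4 x5 x6 x7 => f D.z0 (ev x0) + f D.z1 (ev x1) + f D.z2 (ev x2) + f D.z3 (ev x3) + f D.z4 (ev x4) + f D.z5 (ev x5) + f D.z6 (ev x6) + f D.z7 (ev x7)

def evP : P4 A → T
  | .o => 0
  | .n x0 x1 x2 x3 => f D.p0 (ev x0) + f D.p1 (ev x1) + f D.p2 (ev x2) + f D.p3 (ev x3)

def evN : P4 A → T
  | .o => 0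
  | .n x0 x1 x2 x3 => f D.n0 (ev x0) + f D.n1 (ev x1) + f D.n2 (ev x2) + f D.n3 (ev x3)

/-- Multiplicativity of a bilinear map. -/
structure HF : Prop where
  eq : ∀ q s q' s', f q s * f q' s' = f (q * q') (s * s')

def evM : M A → T
  | .o => 0
  | .n c p m => D.evZ f ev c + D.evP f ev p + D.evN f ev m

variable [Ops A] {l : L → ℂ} {ev : A → S}

theorem evZ_mk (h : Snd l ev) (x0 x1 x2 x3 x4 x5 x6 x7 : A) : D.evZ f ev (Z8.mk x0 x1 x2 x3 x4 x5 x6 x7) =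
    f D.z0 (ev x0) + f D.z1 (ev x1) + f D.z2 (ev x2) + f D.z3 (ev x3) + f D.z4 (ev x4) + f D.z5 (ev x5) + f D.z6 (ev x6) + f D.z7 (ev x7) := by
  unfold Z8.mk
  cases hc : (Ops.nul x0 && Ops.nul x1 && Ops.nul x2 && Ops.nul x3 && Ops.nul x4 && Ops.nul x5 && Ops.nul x6 && Ops.nul x7) with
  | false => rfl
  | true =>
    simp only [Bool.and_eq_true] at hc
    obtain ⟨⟨⟨⟨⟨⟨⟨h0, h1⟩, h2⟩, h3⟩, h4⟩, h5⟩, h6⟩, h7⟩ := hc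
    simp only [cond, evZ, h.nul _ h0, h.nul _ h1, h.nul _ h2, h.nul _ h3, h.nul _ h4, h.nul _ h5, h.nul _ h6, h.nul _ h7, map_zero, add_zero]

theorem evZ_add (h : Snd l ev) (x y : Z8 A) : D.evZ f ev (Z8.add x y) = D.evZ f ev x + D.evZ f ev y := by
  cases x with
  | o => exact (zero_add _).symm
  | n x0 x1 x2 x3 x4 x5 x6 x7 =>
    cases y with
    | o => exact (add_zero _).symm
    | n y0 y1 y2 y3 y4 y5 y6 y7 =>
      refine (D.evZ_mk f h _ _ _ _ _ _ _ _).trans ?_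
      simp only [evZ, h.add, map_add]
      abel

theorem evZ_isz (h : Snd l ev) (x : Z8 A) (hx : Z8.isz x = true) : D.evZ f ev x = 0 := by
  cases x with
  | o => rfl
  | n x0 x1 x2 x3 x4 x5 x6 x7 =>
    have hc : (Ops.isz x0 && Ops.isz x1 && Ops.isz x2 && Ops.isz x3 && Ops.isz x4 && Ops.isz x5 && Ops.isz x6 && Ops.isz x7) = true := hx
    simp only [Bool.and_eq_true] at hc
    obtain ⟨⟨⟨⟨⟨⟨⟨h0, h1⟩, h2⟩, h3⟩, h4⟩, h5⟩, h6⟩, h7⟩ := hc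
    simp only [evZ, h.isz _ h0, h.isz _ h1, h.isz _ h2, h.isz _ h3, h.isz _ h4, h.isz _ h5, h.isz _ h6, h.isz _ h7, map_zero, add_zero]

theorem evZ_nrm (h : Snd l ev) (x : Z8 A) : D.evZ f ev (Z8.nrm x) = D.evZ f ev x := by
  cases x with
  | o => rfl
  | n x0 x1 x2 x3 x4 x5 x6 x7 => exact D.evZ_mk f h _ _ _ _ _ _ _ _

theorem evP_mk (h : Snd l ev) (x0 x1 x2 x3 : A) : D.evP f ev (P4.mk x0 x1 x2 x3) =
    f D.p0 (ev x0) + f D.p1 (ev x1) + f D.p2 (ev x2) + f D.p3 (ev x3) := by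
  unfold P4.mk
  cases hc : (Ops.nul x0 && Ops.nul x1 && Ops.nul x2 && Ops.nul x3) with
  | false => rfl
  | true =>
    simp only [Bool.and_eq_true] at hc
    obtain ⟨⟨⟨h0, h1⟩, h2⟩, h3⟩ := hc
    simp only [cond, evP, h.nul _ h0, h.nul _ h1, h.nul _ h2, h.nul _ h3, map_zero, add_zero]

theorem evP_add (h : Snd l ev) (x y : P4 A) : D.evP f ev (P4.add x y) = D.evP f ev x + D.evP f ev y := by
  cases x with
  | o => exact (zero_add _).symm
  | n x0 x1 x2 x3 =>
    cases y with
    | o => exact (add_zero _).symm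
    | n y0 y1 y2 y3 =>
      refine (D.evP_mk f h _ _ _ _).trans ?_
      simp only [evP, h.add, map_add]
      abel

theorem evP_isz (h : Snd l ev) (x : P4 A) (hx : P4.isz x = true) : D.evP f ev x = 0 := by
  cases x with
  | o => rfl
  | n x0 x1 x2 x3 =>
    have hc : (Ops.isz x0 && Ops.isz x1 && Ops.isz x2 && Ops.isz x3) = true := hx
    simp only [Bool.and_eq_true] at hc
    obtain ⟨⟨⟨h0, h1⟩, h2⟩, h3⟩ := hc
    simp only [evP, h.isz _ h0, h.isz _ h1, h.isz _ h2, h.isz _ h3, map_zero, add_zero]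

theorem evP_nrm (h : Snd l ev) (x : P4 A) : D.evP f ev (P4.nrm x) = D.evP f ev x := by
  cases x with
  | o => rfl
  | n x0 x1 x2 x3 => exact D.evP_mk f h _ _ _ _

theorem evN_mk (h : Snd l ev) (x0 x1 x2 x3 : A) : D.evN f ev (P4.mk x0 x1 x2 x3) =
    f D.n0 (ev x0) + f D.n1 (ev x1) + f D.n2 (ev x2) + f D.n3 (ev x3) := by
  unfold P4.mk
  cases hc : (Ops.nul x0 && Ops.nul x1 && Ops.nul x2 && Ops.nul x3) with
  | false => rfl
  | true =>
    simp only [Bool.and_eq_true] at hc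
    obtain ⟨⟨⟨h0, h1⟩, h2⟩, h3⟩ := hc
    simp only [cond, evN, h.nul _ h0, h.nul _ h1, h.nul _ h2, h.nul _ h3, map_zero, add_zero]

theorem evN_add (h : Snd l ev) (x y : P4 A) : D.evN f ev (P4.add x y) = D.evN f ev x + D.evN f ev y := by
  cases x with
  | o => exact (zero_add _).symm
  | n x0 x1 x2 x3 =>
    cases y with
    | o => exact (add_zero _).symm
    | n y0 y1 y2 y3 =>
      refine (D.evN_mk f h _ _ _ _).trans ?_
      simp only [evN, h.add, map_add]
      abel

theorem evN_isz (h : Snd l ev) (x : P4 A) (hx : P4.isz x = true) : D.evN f ev x = 0 := by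
  cases x with
  | o => rfl
  | n x0 x1 x2 x3 =>
    have hc : (Ops.isz x0 && Ops.isz x1 && Ops.isz x2 && Ops.isz x3) = true := hx
    simp only [Bool.and_eq_true] at hc
    obtain ⟨⟨⟨h0, h1⟩, h2⟩, h3⟩ := hc
    simp only [evN, h.isz _ h0, h.isz _ h1, h.isz _ h2, h.isz _ h3, map_zero, add_zero]

theorem evN_nrm (h : Snd l ev) (x : P4 A) : D.evN f ev (P4.nrm x) = D.evN f ev x := by
  cases x with
  | o => rfl
  | n x0 x1 x2 x3 => exact D.evN_mk f h _ _ _ _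


theorem ev_mulZZ (h : Snd l ev) (hf : HF f) (x : Z8 A) (y : Z8 A) :
    D.evZ f ev (mulZZ x y) = D.evZ f ev x * D.evZ f ev y := by
  cases x with
  | o => exact (zero_mul _).symm
  | n x0 x1 x2 x3 x4 x5 x6 x7 =>
    cases y with
    | o => exact (mul_zero _).symm
    | n y0 y1 y2 y3 y4 y5 y6 y7 =>
      refine (D.evZ_mk f h _ _ _ _ _ _ _ _).trans ?_
      have ht := D.tzz
      simp only [evZ, evZ, mul_add, add_mul, hf.eq, ht, h.add, h.mul, h.zero, map_add, map_zero,
        LinearMap.zero_apply, add_zero, zero_add]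
      try abel

theorem ev_mulZP (h : Snd l ev) (hf : HF f) (x : Z8 A) (y : P4 A) :
    D.evP f ev (mulZP x y) = D.evZ f ev x * D.evP f ev y := by
  cases x with
  | o => exact (zero_mul _).symm
  | n x0 x1 x2 x3 x4 x5 x6 x7 =>
    cases y with
    | o => exact (mul_zero _).symm
    | n y0 y1 y2 y3 =>
      refine (D.evP_mk f h _ _ _ _).trans ?_
      have ht := D.tzp
      simp only [evZ, evP, mul_add, add_mul, hf.eq, ht, h.add, h.mul, h.zero, map_add, map_zero,
        LinearMap.zero_apply, add_zero, zero_add]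
      try abel

theorem ev_mulPZ (h : Snd l ev) (hf : HF f) (x : P4 A) (y : Z8 A) :
    D.evP f ev (mulPZ x y) = D.evP f ev x * D.evZ f ev y := by
  cases x with
  | o => exact (zero_mul _).symm
  | n x0 x1 x2 x3 =>
    cases y with
    | o => exact (mul_zero _).symm
    | n y0 y1 y2 y3 y4 y5 y6 y7 =>
      refine (D.evP_mk f h _ _ _ _).trans ?_
      have ht := D.tpz
      simp only [evP, evZ, mul_add, add_mul, hf.eq, ht, h.add, h.mul, h.zero, map_add, map_zero,
        LinearMap.zero_apply, add_zero, zero_add]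
      try abel

theorem ev_mulZM (h : Snd l ev) (hf : HF f) (x : Z8 A) (y : P4 A) :
    D.evN f ev (mulZM x y) = D.evZ f ev x * D.evN f ev y := by
  cases x with
  | o => exact (zero_mul _).symm
  | n x0 x1 x2 x3 x4 x5 x6 x7 =>
    cases y with
    | o => exact (mul_zero _).symm
    | n y0 y1 y2 y3 =>
      refine (D.evN_mk f h _ _ _ _).trans ?_
      have ht := D.tzn
      simp only [evZ, evN, mul_add, add_mul, hf.eq, ht, h.add, h.mul, h.zero, map_add, map_zero,
        LinearMap.zero_apply, add_zero, zero_add]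
      try abel

theorem ev_mulMZ (h : Snd l ev) (hf : HF f) (x : P4 A) (y : Z8 A) :
    D.evN f ev (mulMZ x y) = D.evN f ev x * D.evZ f ev y := by
  cases x with
  | o => exact (zero_mul _).symm
  | n x0 x1 x2 x3 =>
    cases y with
    | o => exact (mul_zero _).symm
    | n y0 y1 y2 y3 y4 y5 y6 y7 =>
      refine (D.evN_mk f h _ _ _ _).trans ?_
      have ht := D.tnz
      simp only [evN, evZ, mul_add, add_mul, hf.eq, ht, h.add, h.mul, h.zero, map_add, map_zero,
        LinearMap.zero_apply, add_zero, zero_add]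
      try abel

theorem ev_mulPM (h : Snd l ev) (hf : HF f) (x : P4 A) (y : P4 A) :
    D.evZ f ev (mulPM x y) = D.evP f ev x * D.evN f ev y := by
  cases x with
  | o => exact (zero_mul _).symm
  | n x0 x1 x2 x3 =>
    cases y with
    | o => exact (mul_zero _).symm
    | n y0 y1 y2 y3 =>
      refine (D.evZ_mk f h _ _ _ _ _ _ _ _).trans ?_
      have ht := D.tpn
      simp only [evP, evN, mul_add, add_mul, hf.eq, ht, h.add, h.mul, h.zero, map_add, map_zero,
        LinearMap.zero_apply, add_zero, zero_add]
      try abel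

theorem ev_mulMP (h : Snd l ev) (hf : HF f) (x : P4 A) (y : P4 A) :
    D.evZ f ev (mulMP x y) = D.evN f ev x * D.evP f ev y := by
  cases x with
  | o => exact (zero_mul _).symm
  | n x0 x1 x2 x3 =>
    cases y with
    | o => exact (mul_zero _).symm
    | n y0 y1 y2 y3 =>
      refine (D.evZ_mk f h _ _ _ _ _ _ _ _).trans ?_
      have ht := D.tnp
      simp only [evN, evP, mul_add, add_mul, hf.eq, ht, h.add, h.mul, h.zero, map_add, map_zero,
        LinearMap.zero_apply, add_zero, zero_add]
      try abel

theorem ev_tpp (hf : HF f) (x y : P4 A) : D.evP f ev x * D.evP f ev y = 0 := by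
  cases x with
  | o => exact zero_mul _
  | n x0 x1 x2 x3 =>
    cases y with
    | o => exact mul_zero _
    | n y0 y1 y2 y3 =>
      simp only [evP, mul_add, add_mul, hf.eq, D.tpp, map_zero, LinearMap.zero_apply, add_zero]

theorem ev_tnn (hf : HF f) (x y : P4 A) : D.evN f ev x * D.evN f ev y = 0 := by
  cases x with
  | o => exact zero_mul _
  | n x0 x1 x2 x3 =>
    cases y with
    | o => exact mul_zero _
    | n y0 y1 y2 y3 =>
      simp only [evN, mul_add, add_mul, hf.eq, D.tnn, map_zero, LinearMap.zero_apply, add_zero]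

end
end QD


namespace QD
section
variable {Q : Type} [Ring Q] [Algebra ℂ Q] (D : QD Q)
variable {A S T : Type} [Ring S] [Algebra ℂ S] [Ring T] [Algebra ℂ T]
variable (f : Q →ₗ[ℂ] S →ₗ[ℂ] T) {ev : A → S} [Ops A] {l : L → ℂ}

theorem evM_mk (c : Z8 A) (p m : P4 A) :
    D.evM f ev (M.mk c p m) = D.evZ f ev c + D.evP f ev p + D.evN f ev m := by
  cases c <;> cases p <;> cases m <;> first | rfl | simp only [M.mk, Z8.nul, P4.nul, Bool.and_true, cond, evM, evZ, evP, evN, add_zero]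

theorem evM_map {B S' T' : Type} [Ring S'] [Algebra ℂ S'] [Ring T'] [Algebra ℂ T']
    (f' : Q →ₗ[ℂ] S' →ₗ[ℂ] T') (ev' : B → S') (g : B → A) (ψ : T' →ₗ[ℂ] T)
    (H : ∀ q b, f q (ev (g b)) = ψ (f' q (ev' b))) (x : M B) :
    D.evM f ev (M.map g x) = ψ (D.evM f' ev' x) := by
  cases x with
  | o => exact (map_zero ψ).symm
  | n c p m =>
    cases c <;> cases p <;> cases m <;>
      simp only [M.map, Z8.map, P4.map, evM, evZ, evP, evN, map_add, map_zero, H]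

theorem sndM (h : Snd l ev) (hf : HF f) : Snd l (D.evM f ev) where
  zero := rfl
  add x y := by
    cases x with
    | o => exact (zero_add _).symm
    | n c p m =>
      cases y with
      | o => exact (add_zero _).symm
      | n c' p' m' =>
        refine (D.evM_mk f _ _ _).trans ?_
        simp only [D.evZ_add f h, D.evP_add f h, D.evN_add f h, evM]
        abel
  smul c x := by
    refine (D.evM_map f f ev (Ops.smul c) (l c • LinearMap.id) ?_ x)
    intro q b
    simp only [h.smul, map_smul, LinearMap.smul_apply, LinearMap.id_apply]
  mul x y := by
    cases x with
    | o => exact (zero_mul _).symm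
    | n c p m =>
      cases y with
      | o => exact (mul_zero _).symm
      | n c' p' m' =>
        refine (D.evM_mk f _ _ _).trans ?_
        simp only [D.evZ_add f h, D.evP_add f h, D.evN_add f h, evM, D.ev_mulZZ f h hf,
          D.ev_mulZP f h hf, D.ev_mulPZ f h hf, D.ev_mulZM f h hf, D.ev_mulMZ f h hf,
          D.ev_mulPM f h hf, D.ev_mulMP f h hf, mul_add, add_mul, D.ev_tpp f hf, D.ev_tnn f hf]
        abel
  nul x hx := by
    cases x with
    | o => rfl
    | n c p m => exact absurd hx (by simp [Ops.nul, M.nul])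
  isz x hx := by
    cases x with
    | o => rfl
    | n c p m =>
      have hc : (Z8.isz c && P4.isz p && P4.isz m) = true := hx
      simp only [Bool.and_eq_true] at hc
      simp only [evM, D.evZ_isz f h _ hc.1.1, D.evP_isz f h _ hc.1.2, D.evN_isz f h _ hc.2,
        add_zero]

theorem evM_nrm (h : Snd l ev) (x : M A) : D.evM f ev (M.nrm x) = D.evM f ev x := by
  cases x with
  | o => rfl
  | n c p m =>
    refine (D.evM_mk f _ _ _).trans ?_
    simp only [D.evZ_nrm f h, D.evP_nrm f h, D.evN_nrm f h, evM]

/-- `c • q` as a bilinear map. -/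
def fsm (Q : Type) [Ring Q] [Algebra ℂ Q] : Q →ₗ[ℂ] ℂ →ₗ[ℂ] Q := (LinearMap.lsmul ℂ Q).flip

theorem fsm_apply (q : Q) (c : ℂ) : fsm Q q c = c • q := rfl

theorem ev_smz (hl : Snd l l) (h : Snd l ev) (c : L) (a : A) : ev (smz c a) = l c • ev a := by
  unfold smz
  cases hc : L.nul c with
  | true => rw [hl.nul c hc, zero_smul]; exact h.zero
  | false => exact h.smul c a

theorem evM_t (hl : Snd l l) (h : Snd l ev) (x : M L) (a : A) :
    D.evM f ev (M.t x a) = f (D.evM (fsm Q) l x) (ev a) := by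
  refine D.evM_map f (fsm Q) l _ (f.flip (ev a)) ?_ x
  intro q c
  simp only [ev_smz hl h, fsm_apply, LinearMap.flip_apply, map_smul, LinearMap.smul_apply]

/-! ### Permutations -/

def bas : Fin 16 → Q := ![D.z0, D.z1, D.z2, D.z3, D.z4, D.z5, D.z6, D.z7, D.p0, D.p1, D.p2, D.p3, D.n0, D.n1, D.n2, D.n3]

def crd : Fin 16 → M A → A := ![M.pz 0, M.pz 1, M.pz 2, M.pz 3, M.pz 4, M.pz 5, M.pz 6, M.pz 7, M.pp 0, M.pp 1, M.pp 2, M.pp 3, M.pm 0, M.pm 1, M.pm 2, M.pm 3]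

theorem sum16 {T : Type} [AddCommMonoid T] (g : Fin 16 → T) : ∑ i, g i =
    g 0 + g 1 + g 2 + g 3 + g 4 + g 5 + g 6 + g 7 + g 8 + g 9 + g 10 + g 11 + g 12 + g 13 + g 14 + g 15 := by
  simp only [Fin.sum_univ_succ, Fin.sum_univ_zero, add_zero, ← add_assoc]
  rfl

theorem evM_sum (h : Snd l ev) (x : M A) :
    D.evM f ev x = ∑ i, f (D.bas i) (ev (crd i x)) := by
  rw [sum16]
  change _ = f D.z0 (ev (M.pz 0 x)) + f D.z1 (ev (M.pz 1 x)) + f D.z2 (ev (M.pz 2 x)) + f D.z3 (ev (M.pz 3 x)) + f D.z4 (ev (M.pz 4 x)) + f D.z5 (ev (M.pz 5 x)) + f D.z6 (ev (M.pz 6 x)) + f D.z7 (ev (M.pz 7 x)) +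
    f D.p0 (ev (M.pp 0 x)) + f D.p1 (ev (M.pp 1 x)) + f D.p2 (ev (M.pp 2 x)) + f D.p3 (ev (M.pp 3 x)) +
    f D.n0 (ev (M.pm 0 x)) + f D.n1 (ev (M.pm 1 x)) + f D.n2 (ev (M.pm 2 x)) + f D.n3 (ev (M.pm 3 x))
  cases x with
  | o => simp only [M.pz, M.pp, M.pm, h.zero, map_zero, add_zero, evM]
  | n c p m =>
    cases c <;> cases p <;> cases m <;>
      simp only [M.pz, M.pp, M.pm, Z8.p, P4.p, h.zero, map_zero, add_zero, zero_add, evM, evZ, evP, evN] <;>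
      abel

theorem crd_map (i k : Fin 16) (x : M (M A)) : crd i (M.map (crd k) x) = crd k (crd i x) := by
  have h0 : crd k (M.o : M A) = Ops.zero := by fin_cases k <;> rfl
  cases x with
  | o => fin_cases i <;> exact h0.symm
  | n c p m =>
    cases c <;> cases p <;> cases m <;> fin_cases i <;> first | rfl | exact h0.symm

theorem evM_swap {T' : Type} [Ring T'] [Algebra ℂ T'] (f' : Q →ₗ[ℂ] T →ₗ[ℂ] T')
    (h : Snd l ev) (hf : HF f) (ψ : T' →ₗ[ℂ] T')
    (hψ : ∀ q q' s, ψ (f' q (f q' s)) = f' q' (f q s)) (x : M (M A)) :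
    D.evM f' (D.evM f ev) (M.swap x) = ψ (D.evM f' (D.evM f ev) x) := by
  have h2 := D.sndM f h hf
  have hcol : ∀ k : Fin 16, D.evM f ev (M.nrm (M.map (crd k) x)) =
      ∑ i, f (D.bas i) (ev (crd k (crd i x))) := by
    intro k
    rw [D.evM_nrm f h, D.evM_sum f h]
    simp only [crd_map]
  unfold M.swap
  cases hx : M.nul x with
  | true =>
    rw [show x = .o by cases x with
      | o => rfl
      | n c p m => exact absurd hx (by simp [M.nul])]
    exact (map_zero ψ).symm
  | false =>
    refine (D.evM_mk f' _ _ _).trans ?_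
    rw [D.evZ_mk f' h2, D.evP_mk f' h2, D.evN_mk f' h2]
    have hL : ∑ k : Fin 16, f' (D.bas k) (D.evM f ev (M.nrm (M.map (crd k) x))) =
        ψ (D.evM f' (D.evM f ev) x) := by
      rw [D.evM_sum f' h2, map_sum]
      simp only [hcol, map_sum, D.evM_sum f h, hψ]
      exact Finset.sum_comm
    rw [← hL, sum16]
    simp only [← add_assoc]
    rfl

end
end QD

set_option linter.unusedSectionVars false
set_option linter.unusedSimpArgs false

namespace QD
section
variable {Q : Type} [Ring Q] [Algebra ℂ Q] (D : QD Q)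

def v1 (β : ℂ) : M L → Q := D.evM (fsm Q) (evL β)
def v2 (β : ℂ) : M2 → TP2 ℂ Q := D.evM (TensorProduct.mk ℂ Q Q) (D.v1 β)
def v3 (β : ℂ) : M3 → TP3 ℂ Q := D.evM (TensorProduct.mk ℂ Q (TP2 ℂ Q)) (D.v2 β)

theorem hf_fsm : HF (fsm Q) := by
  constructor
  intro q s q' s'
  simp only [fsm_apply, smul_mul_smul_comm]

theorem hf_mk (S : Type) [Ring S] [Algebra ℂ S] : HF (TensorProduct.mk ℂ Q S) := by
  constructor
  intro q s q' s'
  exact Algebra.TensorProduct.tmul_mul_tmul _ _ _ _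

variable {β : ℂ} (hβ : β ^ 4 = -1)

theorem s1 (hβ : β ^ 4 = -1) : Snd (evL β) (D.v1 β) := D.sndM _ (sndL β hβ) hf_fsm
theorem s2 (hβ : β ^ 4 = -1) : Snd (evL β) (D.v2 β) := D.sndM _ (D.s1 hβ) (hf_mk _)
theorem s3 (hβ : β ^ 4 = -1) : Snd (evL β) (D.v3 β) := D.sndM _ (D.s2 hβ) (hf_mk _)

theorem v2_t (hβ : β ^ 4 = -1) (x y : M L) : D.v2 β (M.t x y) = D.v1 β x ⊗ₜ D.v1 β y :=
  D.evM_t _ (sndL β hβ) (D.s1 hβ) x y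
theorem v3_t (hβ : β ^ 4 = -1) (x : M L) (y : M2) : D.v3 β (M.t x y) = D.v1 β x ⊗ₜ D.v2 β y :=
  D.evM_t _ (sndL β hβ) (D.s2 hβ) x y

theorem cN_ev : evL β cN = -1 := by simp [evL, evG, cN]

end

section
variable {T A : Type} [Ring T] [Algebra ℂ T] [Ops A] {β : ℂ} {ev : M A → T} (h : Snd (evL β) ev)
theorem h_add (h : Snd (evL β) ev) (x y : M A) : ev (x + y) = ev x + ev y := h.add x y
theorem h_mul (h : Snd (evL β) ev) (x y : M A) : ev (x * y) = ev x * ev y := h.mul x y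
theorem h_smul (h : Snd (evL β) ev) (c : L) (x : M A) : ev (c • x) = evL β c • ev x := h.smul c x
theorem h_sub (h : Snd (evL β) ev) (x y : M A) : ev (x - y) = ev x - ev y := by
  refine (h.add x _).trans ?_
  rw [h.smul, cN_ev, neg_one_smul, sub_eq_add_neg]
theorem h_eqc (h : Snd (evL β) ev) (x y : M A) (e : eqc x y = true) : ev x = ev y := by
  have e2 := h.isz _ e
  rw [← sub_eq_zero, ← h_sub h]
  exact e2
end

section
variable {Q : Type} [Ring Q] [Algebra ℂ Q] (D : QD Q)
variable {A S T T' : Type} [Ring S] [Algebra ℂ S] [Ring T] [Algebra ℂ T] [Ring T'] [Algebra ℂ T']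
variable (f : Q →ₗ[ℂ] S →ₗ[ℂ] T) (f2 : Q →ₗ[ℂ] T →ₗ[ℂ] T') {ev : A → S} [Ops A] {β : ℂ}
variable (J : TP2 ℂ Q →ₗ[ℂ] S →ₗ[ℂ] T')

theorem ev_bind2 (hβ : β ^ 4 = -1) (h : Snd (evL β) ev)
    (hJ : ∀ q q' s, J (q ⊗ₜ q') s = f2 q (f q' s)) (d : M2) (a : A) :
    D.evM f2 (D.evM f ev) (M.bind2 d a) = J (D.v2 β d) (ev a) := by
  unfold M.bind2
  cases hc : Ops.nul a with
  | true =>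
    rw [h.nul a hc, map_zero]
    rfl
  | false =>
    refine D.evM_map f2 (TensorProduct.mk ℂ Q Q) (D.v1 β) _ (J.flip (ev a)) ?_ d
    intro q b
    refine (congrArg (f2 q) (D.evM_t f (sndL β hβ) h b a)).trans ?_
    exact (hJ _ _ _).symm

/-- The table of coproducts is correct. -/
structure HD (s : Bool) (β : ℂ) (Δ : Q →ₐ[ℂ] TP2 ℂ Q) : Prop where
  z0 : D.v2 β (dZ s 0) = Δ D.z0
  z1 : D.v2 β (dZ s 1) = Δ D.z1
  z2 : D.v2 β (dZ s 2) = Δ D.z2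
  z3 : D.v2 β (dZ s 3) = Δ D.z3
  z4 : D.v2 β (dZ s 4) = Δ D.z4
  z5 : D.v2 β (dZ s 5) = Δ D.z5
  z6 : D.v2 β (dZ s 6) = Δ D.z6
  z7 : D.v2 β (dZ s 7) = Δ D.z7
  p0 : D.v2 β (dP s 0) = Δ D.p0
  p1 : D.v2 β (dP s 1) = Δ D.p1
  p2 : D.v2 β (dP s 2) = Δ D.p2
  p3 : D.v2 β (dP s 3) = Δ D.p3
  n0 : D.v2 β (dM s 0) = Δ D.n0
  n1 : D.v2 β (dM s 1) = Δ D.n1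
  n2 : D.v2 β (dM s 2) = Δ D.n2
  n3 : D.v2 β (dM s 3) = Δ D.n3

theorem ev_mcop (hβ : β ^ 4 = -1) (h : Snd (evL β) ev) (hf : HF f) (hf2 : HF f2)
    (hJ : ∀ q q' s, J (q ⊗ₜ q') s = f2 q (f q' s)) {s : Bool} {Δ : Q →ₐ[ℂ] TP2 ℂ Q}
    (hD : D.HD s β Δ) (φ : T →ₗ[ℂ] T') (hφ : ∀ q s, φ (f q s) = J (Δ q) s) (x : M A) :
    D.evM f2 (D.evM f ev) (mcop s x) = φ (D.evM f ev x) := by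
  have h2 := D.sndM f h hf
  have h3 := D.sndM f2 h2 hf2
  have ha : ∀ x y : M (M A), D.evM f2 (D.evM f ev) (M.add x y) =
    D.evM f2 (D.evM f ev) x + D.evM f2 (D.evM f ev) y := h3.add
  have h0 : D.evM f2 (D.evM f ev) M.o = 0 := rfl
  have hb := D.ev_bind2 f f2 J hβ h hJ
  clear h2 h3
  generalize D.evM f2 (D.evM f ev) = V at ha h0 hb ⊢
  cases x with
  | o => exact h0.trans (map_zero φ).symm
  | n c p m =>
    cases c <;> cases p <;> cases m <;>
      simp only [mcop, ha, h0, hb, evM, evZ, evP, evN, map_add, map_zero, hφ,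
        hD.z0, hD.z1, hD.z2, hD.z3, hD.z4, hD.z5, hD.z6, hD.z7, hD.p0, hD.p1, hD.p2, hD.p3,
        hD.n0, hD.n1, hD.n2, hD.n3, add_assoc]
end

section
variable {Q : Type} [Ring Q] [Algebra ℂ Q] (D : QD Q) {β : ℂ} {s : Bool} {Δ : Q →ₐ[ℂ] TP2 ℂ Q}

theorem cop1 (hβ : β ^ 4 = -1) (hD : D.HD s β Δ) (x : M L) : D.v2 β (mcop s x) = Δ (D.v1 β x) := by
  refine D.ev_mcop (fsm Q) (TensorProduct.mk ℂ Q Q) (fsm (TP2 ℂ Q)) hβ (sndL β hβ) hf_fsm (hf_mk _)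
    ?_ hD Δ.toLinearMap ?_ x
  · intro q q' c
    simp only [fsm_apply, TensorProduct.mk_apply, TensorProduct.tmul_smul]
  · intro q c
    simp only [fsm_apply, AlgHom.toLinearMap_apply, map_smul]

theorem cop2 (hβ : β ^ 4 = -1) (hD : D.HD s β Δ) (x : M2) : D.v3 β (mcop s x) = copL Δ (D.v2 β x) := by
  refine D.ev_mcop (TensorProduct.mk ℂ Q Q) (TensorProduct.mk ℂ Q (TP2 ℂ Q))
    ((TensorProduct.mk ℂ (TP2 ℂ Q) Q).compr₂ (TensorProduct.assoc ℂ Q Q Q).toLinearMap) hβ (D.s1 hβ)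
    (hf_mk _) (hf_mk _) ?_ hD (copL Δ) ?_ x
  · intro q q' c
    rfl
  · intro q c
    rfl

theorem map2 (ψ : TP2 ℂ Q →ₗ[ℂ] TP2 ℂ Q) (g : M2 → M2) (hg : ∀ b, D.v2 β (g b) = ψ (D.v2 β b))
    (x : M3) : D.v3 β (M.map g x) = TensorProduct.map LinearMap.id ψ (D.v3 β x) := by
  refine D.evM_map (TensorProduct.mk ℂ Q (TP2 ℂ Q)) (TensorProduct.mk ℂ Q (TP2 ℂ Q)) (D.v2 β) g _ ?_ x
  intro q b
  rw [TensorProduct.mk_apply, hg]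
  rfl

theorem map12 (ψ : Q →ₗ[ℂ] TP2 ℂ Q) (g : M L → M2) (hg : ∀ b, D.v2 β (g b) = ψ (D.v1 β b))
    (x : M2) : D.v3 β (M.map g x) = TensorProduct.map LinearMap.id ψ (D.v2 β x) := by
  refine D.evM_map (TensorProduct.mk ℂ Q (TP2 ℂ Q)) (TensorProduct.mk ℂ Q Q) (D.v1 β) g _ ?_ x
  intro q b
  rw [TensorProduct.mk_apply, hg]
  rfl

theorem map21 (ψ : TP2 ℂ Q →ₗ[ℂ] Q) (g : M2 → M L) (hg : ∀ b, D.v1 β (g b) = ψ (D.v2 β b))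
    (x : M3) : D.v2 β (M.map g x) = TensorProduct.map LinearMap.id ψ (D.v3 β x) := by
  refine D.evM_map (TensorProduct.mk ℂ Q Q) (TensorProduct.mk ℂ Q (TP2 ℂ Q)) (D.v2 β) g _ ?_ x
  intro q b
  rw [TensorProduct.mk_apply, hg]
  rfl

theorem copR2 (hβ : β ^ 4 = -1) (hD : D.HD s β Δ) (x : M2) :
    D.v3 β (M.map (mcop s) x) = copR Δ (D.v2 β x) :=
  D.map12 Δ.toLinearMap _ (D.cop1 hβ hD) x

theorem sw2 (hβ : β ^ 4 = -1) (x : M2) : D.v2 β (M.swap x) = flipA ℂ Q (D.v2 β x) := by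
  refine D.evM_swap (fsm Q) (TensorProduct.mk ℂ Q Q) (sndL β hβ) hf_fsm (flipA ℂ Q) ?_ x
  intro q q' c
  simp only [fsm_apply, TensorProduct.mk_apply, TensorProduct.tmul_smul, map_smul]
  rfl

theorem sw3 (hβ : β ^ 4 = -1) (x : M3) : D.v3 β (p213 x) = perm213 ℂ Q (D.v3 β x) := by
  refine D.evM_swap (TensorProduct.mk ℂ Q Q) (TensorProduct.mk ℂ Q (TP2 ℂ Q)) (D.s1 hβ) (hf_mk _)
    (perm213 ℂ Q) ?_ x
  intro q q' c
  rfl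

theorem ev_p132 (hβ : β ^ 4 = -1) (x : M3) : D.v3 β (p132 x) = perm132 ℂ Q (D.v3 β x) :=
  D.map2 _ _ (D.sw2 hβ) x

theorem perm231_eq : perm231 ℂ Q = perm132 ℂ Q ∘ₗ perm213 ℂ Q := by
  ext a b c
  rfl
theorem perm312_eq : perm312 ℂ Q = perm213 ℂ Q ∘ₗ perm132 ℂ Q := by
  ext a b c
  rfl

theorem ev_p231 (hβ : β ^ 4 = -1) (x : M3) : D.v3 β (p231 x) = perm231 ℂ Q (D.v3 β x) := by
  rw [perm231_eq, LinearMap.comp_apply, ← D.sw3 hβ, ← D.ev_p132 hβ]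
  rfl
theorem ev_p312 (hβ : β ^ 4 = -1) (x : M3) : D.v3 β (p312 x) = perm312 ℂ Q (D.v3 β x) := by
  rw [perm312_eq, LinearMap.comp_apply, ← D.ev_p132 hβ, ← D.sw3 hβ]
  rfl

/-! ### Generators -/

theorem v1_1 : D.v1 β m1 = 1 := by
  rw [← D.wsum]
  simp [v1, m1, evM, evZ, evP, evN, fsm_apply, cO, evL, evG, z0, z1, z2, z3, z4, z5, z6, z7]
  abel
theorem v1_E : D.v1 β mE = D.E := by
  have h : D.E * (D.w0 + D.w1 + D.w2 + D.w3) = D.E := by rw [wsum, mul_one]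
  rw [← h]
  simp [v1, mE, evM, evZ, evP, evN, fsm_apply, cO, evL, evG, p0, p1, p2, p3, mul_add]
  abel
theorem v1_F : D.v1 β mF = D.F := by
  have h : D.F * (D.w0 + D.w1 + D.w2 + D.w3) = D.F := by rw [wsum, mul_one]
  rw [← h]
  simp [v1, mF, evM, evZ, evP, evN, fsm_apply, cO, cN, evL, evG, n0, n1, n2, n3, mul_add]
  abel
theorem cni_ev (hs : evL β (ci s) = Complex.I) : evL β (cni s) = -Complex.I := by
  rw [← hs]
  cases s <;> simp [cni, ci, evL, evG]
theorem cO_ev : evL β cO = 1 := by simp [evL, evG, cO]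
theorem v1_K (hs : evL β (ci s) = Complex.I) : D.v1 β (mK s) = D.K := by
  rw [D.Kw]
  simp only [v1, mK, evM, evZ, evP, evN, fsm_apply, evL_o, cO_ev, cN_ev, hs, cni_ev hs, z0, z1, z2,
    z3, z4, z5, z6, z7]
  module
theorem v1_Ki (hs : evL β (ci s) = Complex.I) : D.v1 β (mKi s) = D.K ^ 3 := by
  rw [D.K3w]
  simp only [v1, mKi, evM, evZ, evP, evN, fsm_apply, evL_o, cO_ev, cN_ev, hs, cni_ev hs, z0, z1, z2,
    z3, z4, z5, z6, z7]
  module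
theorem v1_w0 : D.v1 β mw0 = D.w0 := by
  simp [v1, mw0, evM, evZ, evP, evN, fsm_apply, cO_ev, evL_o, z0]
theorem v1_w2 : D.v1 β mw2 = D.w2 := by
  simp [v1, mw2, evM, evZ, evP, evN, fsm_apply, cO_ev, evL_o, z2]
theorem v1_w1 : D.v1 β mw1 = D.w1 := by
  simp [v1, mw1, evM, evZ, evP, evN, fsm_apply, cO_ev, evL_o, z4, z6]
theorem v1_w3 : D.v1 β mw3 = D.w3 := by
  simp [v1, mw3, evM, evZ, evP, evN, fsm_apply, cO_ev, evL_o, z5, z7]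
theorem v1_e0 : D.v1 β me0 = (2:ℂ)⁻¹ • (1 + D.K ^ 2) := by
  simp only [v1, me0, evM, evZ, evP, evN, fsm_apply, cO_ev, evL_o, z0, z1, z2, z3, z4, z5, z6, z7,
    w0, w2, wv, neg_sq, Odd.neg_one_pow (by decide : Odd 3)]
  module
theorem v1_e1 : D.v1 β me1 = (2:ℂ)⁻¹ • (1 - D.K ^ 2) := by
  simp only [v1, me1, evM, evZ, evP, evN, fsm_apply, cO_ev, evL_o, z0, z1, z2, z3, z4, z5, z6, z7,
    w1, w3, wv, I3, In3, neg_sq, Complex.I_sq]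
  module

theorem ev_r13 (hβ : β ^ 4 = -1) (x : M2) : D.v3 β (r13 x) = emb13 ℂ Q (D.v2 β x) := by
  refine D.map12 (rTen ℂ Q) _ ?_ x
  intro b
  rw [D.v2_t hβ, v1_1]
  rfl
theorem sm1 (hβ : β ^ 4 = -1) (b : M L) :
    D.v2 β (M.map (fun c => Ops.smul c m1) b) = lTen ℂ Q (D.v1 β b) := by
  refine D.evM_map (TensorProduct.mk ℂ Q Q) (fsm Q) (evL β) _ (lTen ℂ Q) ?_ b
  intro q c
  rw [(D.s1 hβ).smul, v1_1, fsm_apply, map_smul]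
  simp only [TensorProduct.mk_apply, TensorProduct.tmul_smul]
  rfl
theorem ev_r12 (hβ : β ^ 4 = -1) (x : M2) : D.v3 β (r12 x) = emb12 ℂ Q (D.v2 β x) :=
  D.map12 (lTen ℂ Q) _ (D.sm1 hβ) x
theorem ev_r23 (hβ : β ^ 4 = -1) (x : M2) : D.v3 β (r23 x) = emb23 ℂ Q (D.v2 β x) := by
  refine (D.v3_t hβ _ _).trans ?_
  rw [v1_1]
  rfl
theorem ev_cu (hβ : β ^ 4 = -1) (ce : Q →ₐ[ℂ] ℂ) (hE : ce D.E = 0) (hF : ce D.F = 0)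
    (hK : ce D.K = 1) (x : M3) : D.v2 β (M.map (M.pz 0) x) = cuMid ce (D.v3 β x) := by
  refine D.map21 (cuL ce) _ ?_ x
  intro b
  have h := D.evM_sum (TensorProduct.mk ℂ Q Q) (D.s1 hβ) b
  have hw (c : ℂ) : ce (D.wv c) = 4⁻¹ * (1 + c + c ^ 2 + c ^ 3) := by
    simp only [wv, map_smul, map_add, map_one, map_pow, hK, smul_eq_mul, one_pow, mul_one]
  have h0 : ce D.w0 = 1 := by rw [w0, hw]; norm_num
  have h1 : ce D.w1 = 0 := by rw [w1, hw, In3, neg_sq, Complex.I_sq]; ring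
  have h2 : ce D.w2 = 0 := by rw [w2, hw]; norm_num
  have h3 : ce D.w3 = 0 := by rw [w3, hw, I3, Complex.I_sq]; ring
  have hc (q r : Q) : cuL ce (q ⊗ₜ r) = ce q • r := rfl
  rw [v2, h, map_sum, sum16]
  simp only [TensorProduct.mk_apply, hc]
  simp [bas, z0, z1, z2, z3, z4, z5, z6, z7, p0, p1, p2, p3, n0, n1, n2, n3, h0, h1, h2, h3, hE, hF]
  rfl
end
end QD

theorem chk_half : ∀ s, eqc (lI 2 0 • mR s) (mRR s) = true := by decide +kernel
theorem chk_RI : ∀ s, (eqc (mR s * mRI s) (mt2 m1 m1) && eqc (mRI s * mR s) (mt2 m1 m1)) = true := by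
  decide +kernel
theorem chk_PhiI : ∀ s, (eqc (mPhi s * mPhiI s) (mt3 m1 m1 m1) &&
    eqc (mPhiI s * mPhi s) (mt3 m1 m1 m1)) = true := by
  decide +kernel
theorem chk_hex1 : ∀ s, eqc (p231 (mPhi s) * mcop s (mR s) * mPhi s)
    (r13 (mR s) * p132 (mPhi s) * r23 (mR s)) = true := by
  decide +kernel
theorem chk_hex2 : ∀ s, eqc (M.map (mcop s) (mR s))
    (p312 (mPhi s) * r13 (mR s) * p213 (mPhiI s) * r12 (mR s) * mPhi s) = true := by
  decide +kernel
theorem chk_pent : ∀ s, eqc (mcop s (mPhi s) * M.map (M.map (mcop s)) (mPhi s))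
    (M.map (M.map (M.map (fun c => Ops.smul c m1))) (mPhi s) * M.map (mcop s) (mPhi s) *
      M.t m1 (mPhi s)) = true := by
  decide +kernel
theorem chk_w : ∀ s,
    (eqc (lI 4 0 • dw0) (d1 + cO • dK s + cO • (dK s * dK s) + cO • (dK s * (dK s * dK s))) &&
    eqc (lI 4 0 • dw1) (d1 + cni s • dK s + cN • (dK s * dK s) + ci s • (dK s * (dK s * dK s))) &&
    eqc (lI 4 0 • dw2) (d1 + cN • dK s + cO • (dK s * dK s) + cN • (dK s * (dK s * dK s))) &&
    eqc (lI 4 0 • dw3) (d1 + ci s • dK s + cN • (dK s * dK s) + cni s • (dK s * (dK s * dK s)))) = true := by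
  decide +kernel
theorem chk_cu : ∀ s, eqc (M.map (M.pz 0) (mPhi s)) (mt2 m1 m1) = true := by decide +kernel
theorem chk_int : ∀ s, (eqc (mcop s (dE s) * mPhi s) (mPhi s * M.map (mcop s) (dE s)) &&
    eqc (mcop s (dF s) * mPhi s) (mPhi s * M.map (mcop s) (dF s)) &&
    eqc (mcop s (dK s) * mPhi s) (mPhi s * M.map (mcop s) (dK s))) = true := by
  decide +kernel
theorem chk_op : ∀ s, (eqc (mR s * dE s) (M.swap (dE s) * mR s) &&
    eqc (mR s * dF s) (M.swap (dF s) * mR s) &&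
    eqc (mR s * dK s) (M.swap (dK s) * mR s)) = true := by
  decide +kernel

set_option linter.unusedSimpArgs false
theorem dZ_0 (s : Bool) : dZ s 0 = M.nrm (M.map M.nrm (dw0)) := by
  delta dZ
  exact rfl
theorem dZ_1 (s : Bool) : dZ s 1 = M.nrm (M.map M.nrm (dE s * (dF s * dw0))) := by
  delta dZ
  exact rfl
theorem dZ_2 (s : Bool) : dZ s 2 = M.nrm (M.map M.nrm (dw2)) := by
  delta dZ
  exact rfl
theorem dZ_3 (s : Bool) : dZ s 3 = M.nrm (M.map M.nrm (dE s * (dF s * dw2))) := by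
  delta dZ
  exact rfl
theorem dZ_4 (s : Bool) : dZ s 4 = M.nrm (M.map M.nrm (dE s * (dF s * dw1))) := by
  delta dZ
  exact rfl
theorem dZ_5 (s : Bool) : dZ s 5 = M.nrm (M.map M.nrm (dE s * (dF s * dw3) + dw3)) := by
  delta dZ
  exact rfl
theorem dZ_6 (s : Bool) : dZ s 6 = M.nrm (M.map M.nrm (dw1 - dE s * (dF s * dw1))) := by
  delta dZ
  exact rfl
theorem dZ_7 (s : Bool) : dZ s 7 = M.nrm (M.map M.nrm (cN • (dE s * (dF s * dw3)))) := by
  delta dZ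
  exact rfl
theorem dP_0 (s : Bool) : dP s 0 = M.nrm (M.map M.nrm (dE s * dw0)) := by
  delta dP
  exact rfl
theorem dP_1 (s : Bool) : dP s 1 = M.nrm (M.map M.nrm (dE s * dw2)) := by
  delta dP
  exact rfl
theorem dP_2 (s : Bool) : dP s 2 = M.nrm (M.map M.nrm (dE s * dw3)) := by
  delta dP
  exact rfl
theorem dP_3 (s : Bool) : dP s 3 = M.nrm (M.map M.nrm (dE s * dw1)) := by
  delta dP
  exact rfl
theorem dM_0 (s : Bool) : dM s 0 = M.nrm (M.map M.nrm (dF s * dw0)) := by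
  delta dM
  exact rfl
theorem dM_1 (s : Bool) : dM s 1 = M.nrm (M.map M.nrm (dF s * dw2)) := by
  delta dM
  exact rfl
theorem dM_2 (s : Bool) : dM s 2 = M.nrm (M.map M.nrm (dF s * dw1)) := by
  delta dM
  exact rfl
theorem dM_3 (s : Bool) : dM s 3 = M.nrm (M.map M.nrm (cN • (dF s * dw3))) := by
  delta dM
  exact rfl
namespace QD
section
variable {Q : Type} [Ring Q] [Algebra ℂ Q] (D : QD Q)

def u2 (a b : Q) : TP2 ℂ Q := a ⊗ₜ[ℂ] b
def u3 (a b c : Q) : TP3 ℂ Q := a ⊗ₜ[ℂ] (b ⊗ₜ[ℂ] c)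
def ae0 : Q := (2:ℂ)⁻¹ • (1 + D.K ^ 2)
def ae1 : Q := (2:ℂ)⁻¹ • (1 - D.K ^ 2)
def aPhi010 : TP3 ℂ Q :=
  u3 1 1 1 - (1 + Complex.I) • u3 D.E D.K D.F + (1 - Complex.I) • u3 (D.F * D.K) D.K (D.E * D.K)
    + (2:ℂ) • u3 (D.E * D.F * D.K) 1 (D.E * D.F * D.K)
def aPhi101 : TP3 ℂ Q :=
  (Complex.I - 1) • u3 1 D.F (D.E * D.K) + u3 1 D.K 1 + (2:ℂ) • u3 1 (D.E * D.F) (D.E * D.F * D.K)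
    - (1 + Complex.I) • u3 1 (D.E * D.K) D.F - (1 + Complex.I) • u3 D.E (D.F * D.K) 1
    + (2 * Complex.I) • u3 D.E (D.E * D.F * D.K) D.F + (1 - Complex.I) • u3 (D.F * D.K) D.E 1
    - (2 * Complex.I) • u3 (D.F * D.K) (D.E * D.F * D.K) (D.E * D.K) - (2:ℂ) • u3 (D.E * D.F * D.K) (D.E * D.F) 1
def aPhi111 (β : ℂ) : TP3 ℂ Q :=
  (Complex.I * β ^ 2) • (
    (1 + Complex.I) • u3 1 D.F (D.E * D.K) - u3 1 D.K 1 - (2:ℂ) • u3 1 (D.E * D.F) 1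
      - (2 * Complex.I) • u3 1 (D.E * D.F) (D.E * D.F * D.K) + (1 + Complex.I) • u3 1 (D.E * D.K) D.F
      - (1 + Complex.I) • u3 D.E 1 D.F + (1 + Complex.I) • u3 D.E (D.F * D.K) 1
      + (2 * Complex.I) • u3 D.E (D.F * D.K) (D.E * D.F * D.K) + (2:ℂ) • u3 D.E (D.E * D.F * D.K) D.F
      - (1 + Complex.I) • u3 (D.F * D.K) 1 (D.E * D.K) + (1 + Complex.I) • u3 (D.F * D.K) D.E 1
      + (2 * Complex.I) • u3 (D.F * D.K) D.E (D.E * D.F * D.K) + (2:ℂ) • u3 (D.F * D.K) (D.E * D.F * D.K) (D.E * D.K)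
      + (2 * Complex.I) • u3 (D.E * D.F * D.K) D.F (D.E * D.K) + (2 * Complex.I) • u3 (D.E * D.F * D.K) D.K (D.E * D.F * D.K)
      - (2 * Complex.I) • u3 (D.E * D.F * D.K) (D.E * D.F) 1 + (2 * Complex.I) • u3 (D.E * D.F * D.K) (D.E * D.K) D.F
      + (4:ℂ) • u3 (D.E * D.F * D.K) (D.E * D.F) (D.E * D.F * D.K))
def aPhi (β : ℂ) : TP3 ℂ Q :=
  u3 D.ae0 D.ae0 D.ae0 + u3 D.ae1 D.ae0 D.ae0 + D.aPhi010 * u3 D.ae0 D.ae1 D.ae0 + u3 D.ae0 D.ae0 D.ae1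
    + u3 D.ae1 D.ae1 D.ae0 + D.aPhi101 * u3 D.ae1 D.ae0 D.ae1 + u3 D.ae0 D.ae1 D.ae1 + (D.aPhi111 β) * u3 D.ae1 D.ae1 D.ae1
def aR00 : TP2 ℂ Q :=
  (2:ℂ)⁻¹ • ((u2 1 1 + u2 1 D.K + u2 D.K 1 - u2 D.K D.K) * (u2 1 1 + (2 * Complex.I) • u2 D.E D.F))
def aR01 : TP2 ℂ Q :=
  (2:ℂ)⁻¹ • ((u2 1 1 - Complex.I • u2 1 D.K + u2 D.K 1 + Complex.I • u2 D.K D.K) *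
    (u2 1 1 + (1 - Complex.I) • u2 (D.F * D.K) (D.E * D.K) - (1 - Complex.I) • u2 D.E D.F
      + (1 + Complex.I) • u2 (D.E * D.F * D.K) 1 + (2 * Complex.I) • u2 (D.E * D.F * D.K) (D.E * D.F * D.K)))
def aR10 : TP2 ℂ Q :=
  (2:ℂ)⁻¹ • ((u2 1 1 + u2 1 D.K - Complex.I • u2 D.K 1 + Complex.I • u2 D.K D.K) *
    (u2 1 D.K + (1 - Complex.I) • u2 (D.F * D.K) D.E + (1 - Complex.I) • u2 D.E (D.F * D.K)
      - (1 - Complex.I) • u2 1 (D.E * D.F) - (2 * Complex.I) • u2 (D.E * D.F * D.K) (D.E * D.F)))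
def aR11 (β : ℂ) : TP2 ℂ Q :=
  (β / 2) • ((u2 1 1 - Complex.I • u2 1 D.K - Complex.I • u2 D.K 1 + u2 D.K D.K) *
    ((-Complex.I) • u2 D.K 1 + (2 * Complex.I) • u2 (D.E * D.K) D.F + (1 - Complex.I) • u2 D.K (D.E * D.F * D.K)
      - (1 + Complex.I) • u2 (D.E * D.F) 1 - (2 * Complex.I) • u2 (D.E * D.F) (D.E * D.F * D.K)))
def aRmat (β : ℂ) : TP2 ℂ Q :=
  D.aR00 * u2 D.ae0 D.ae0 + D.aR01 * u2 D.ae0 D.ae1 + D.aR10 * u2 D.ae1 D.ae0 + (D.aR11 β) * u2 D.ae1 D.ae1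

variable {β : ℂ} {s : Bool}

theorem v2_mt (hβ : β ^ 4 = -1) (x y : M L) : D.v2 β (mt2 x y) = u2 (D.v1 β x) (D.v1 β y) :=
  D.v2_t hβ x y
theorem v3_mt (hβ : β ^ 4 = -1) (x y z : M L) :
    D.v3 β (mt3 x y z) = u3 (D.v1 β x) (D.v1 β y) (D.v1 β z) := by
  refine (D.v3_t hβ x _).trans ?_
  rw [D.v2_t hβ]
  rfl

theorem lI_ev (a b : Int) : evL β (lI a b) = a + b * β ^ 2 := by
  rw [lI, evL_e, evG_mk]
theorem cg_ev (hβ : β ^ 4 = -1) (hs : evL β (ci s) = Complex.I) (a b : Int) :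
    evL β (cg s a b) = a + b * Complex.I := by
  refine ((sndL β hβ).add _ _).trans ?_
  rw [lI_ev]
  refine (congrArg _ ((sndL β hβ).mul _ _)).trans ?_
  rw [lI_ev, hs]
  simp
theorem cP_ev (hβ : β ^ 4 = -1) (hs : evL β (ci s) = Complex.I) :
    evL β (L.mul (ci s) (lI 0 1)) = Complex.I * β ^ 2 := by
  refine ((sndL β hβ).mul _ _).trans ?_
  rw [lI_ev, hs]
  simp
theorem cB_ev : evL β cB = β := by simp [evL, evG, cB]

theorem v1_EF (hβ : β ^ 4 = -1) : D.v1 β mEF = D.E * D.F := by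
  rw [mEF, h_mul (D.s1 hβ), v1_E, v1_F]
theorem v1_EK (hβ : β ^ 4 = -1) (hs : evL β (ci s) = Complex.I) : D.v1 β (mEK s) = D.E * D.K := by
  rw [mEK, h_mul (D.s1 hβ), v1_E, D.v1_K hs]
theorem v1_FK (hβ : β ^ 4 = -1) (hs : evL β (ci s) = Complex.I) : D.v1 β (mFK s) = D.F * D.K := by
  rw [mFK, h_mul (D.s1 hβ), v1_F, D.v1_K hs]
theorem v1_EFK (hβ : β ^ 4 = -1) (hs : evL β (ci s) = Complex.I) :
    D.v1 β (mEFK s) = D.E * D.F * D.K := by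
  rw [mEFK, h_mul (D.s1 hβ), h_mul (D.s1 hβ), v1_E, v1_F, D.v1_K hs]

theorem ev_Phi (hβ : β ^ 4 = -1) (hs : evL β (ci s) = Complex.I) : D.v3 β (mPhi s) = D.aPhi β := by
  have c1 : evL β (cg s 1 1) = 1 + Complex.I := by rw [cg_ev hβ hs]; push_cast; ring
  have c2 : evL β (cg s 1 (-1)) = 1 - Complex.I := by rw [cg_ev hβ hs]; push_cast; ring
  have c3 : evL β (cg s 2 0) = 2 := by rw [cg_ev hβ hs]; push_cast; ring
  have c4 : evL β (cg s 0 2) = 2 * Complex.I := by rw [cg_ev hβ hs]; push_cast; ring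
  have c5 : evL β (cg s (-1) 1) = Complex.I - 1 := by rw [cg_ev hβ hs]; push_cast; ring
  have c6 : evL β (cg s 4 0) = 4 := by rw [cg_ev hβ hs]; push_cast; ring
  have ha := h_add (D.s3 hβ)
  have hb := h_sub (D.s3 hβ)
  have hc := h_smul (D.s3 hβ)
  have hm := h_mul (D.s3 hβ)
  simp only [mPhi, mP010, mP101, mP111, ha, hb, hc, hm, D.v3_mt hβ, v1_1, v1_E, v1_F,
    D.v1_K hs, D.v1_EF hβ, D.v1_EK hβ hs, D.v1_FK hβ hs, D.v1_EFK hβ hs, v1_e0, v1_e1,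
    c1, c2, c3, c4, c5, c6, cP_ev hβ hs]
  rfl

theorem ev_RR (hβ : β ^ 4 = -1) (hs : evL β (ci s) = Complex.I) :
    D.v2 β (mRR s) = (2:ℂ) • D.aRmat β := by
  have c1 : evL β (cg s 1 1) = 1 + Complex.I := by rw [cg_ev hβ hs]; push_cast; ring
  have c2 : evL β (cg s 1 (-1)) = 1 - Complex.I := by rw [cg_ev hβ hs]; push_cast; ring
  have c4 : evL β (cg s 0 2) = 2 * Complex.I := by rw [cg_ev hβ hs]; push_cast; ring
  have c5 : evL β (cg s 0 (-1)) = -Complex.I := by rw [cg_ev hβ hs]; push_cast; ring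
  have ha := h_add (D.s2 hβ)
  have hb := h_sub (D.s2 hβ)
  have hc := h_smul (D.s2 hβ)
  have hm := h_mul (D.s2 hβ)
  have h2 (X : TP2 ℂ Q) (Y : TP2 ℂ Q) : (2:ℂ) • (((2:ℂ)⁻¹ • X) * Y) = X * Y := by
    rw [smul_mul_assoc, smul_smul, mul_inv_cancel₀ two_ne_zero, one_smul]
  have h3 (X : TP2 ℂ Q) (Y : TP2 ℂ Q) : (2:ℂ) • (((β / 2) • X) * Y) = (β • X) * Y := by
    rw [smul_mul_assoc, smul_smul, mul_div_cancel₀ _ two_ne_zero, smul_mul_assoc]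
  rw [aRmat, smul_add, smul_add, smul_add, aR00, aR01, aR10, aR11, h2, h2, h2, h3]
  simp only [mRR, mR00, mR01, mR10, mR11, ha, hb, hc, hm, D.v2_mt hβ, v1_1, v1_E, v1_F,
    D.v1_K hs, D.v1_EF hβ, D.v1_EK hβ hs, D.v1_FK hβ hs, D.v1_EFK hβ hs, v1_e0, v1_e1,
    c1, c2, c4, c5, cB_ev, hs]
  rfl

theorem ev_R (hβ : β ^ 4 = -1) (hs : evL β (ci s) = Complex.I) : D.v2 β (mR s) = D.aRmat β := by
  have h := h_eqc (D.s2 hβ) _ _ (chk_half s)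
  rw [h_smul (D.s2 hβ), D.ev_RR hβ hs, lI_ev] at h
  have h2 : (((2:Int):ℂ) + ((0:Int):ℂ) * β ^ 2) = 2 := by push_cast; ring
  rw [h2] at h
  have h3 := congrArg (fun X => (2:ℂ)⁻¹ • X) h
  simpa only [smul_smul, inv_mul_cancel₀ (two_ne_zero : (2:ℂ) ≠ 0), one_smul] using h3

/-! ### Coproduct table -/

variable {Δ : Q →ₐ[ℂ] TP2 ℂ Q}

theorem ev_dK (hβ : β ^ 4 = -1) (hs : evL β (ci s) = Complex.I) (hK : Δ D.K = D.K ⊗ₜ D.K) :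
    D.v2 β (dK s) = Δ D.K := by
  rw [dK, D.v2_mt hβ, D.v1_K hs, hK]
  rfl
theorem ev_dE (hβ : β ^ 4 = -1) (hs : evL β (ci s) = Complex.I)
    (hE : Δ D.E = 1 ⊗ₜ D.E + D.E ⊗ₜ D.K) : D.v2 β (dE s) = Δ D.E := by
  rw [dE, h_add (D.s2 hβ), D.v2_mt hβ, D.v2_mt hβ, D.v1_K hs, v1_1, v1_E, hE]
  rfl
theorem ev_dF (hβ : β ^ 4 = -1) (hs : evL β (ci s) = Complex.I)
    (hF : Δ D.F = (D.K ^ 3) ⊗ₜ D.F + D.F ⊗ₜ 1) : D.v2 β (dF s) = Δ D.F := by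
  rw [dF, h_add (D.s2 hβ), D.v2_mt hβ, D.v2_mt hβ, D.v1_Ki hs, v1_1, v1_F, hF]
  rfl

theorem ev_dw (hβ : β ^ 4 = -1) (hK : D.v2 β (dK s) = Δ D.K) (d : M2) (c1 c2 c3 : L) (c : ℂ)
    (h1 : evL β c1 = c) (h2 : evL β c2 = c ^ 2) (h3 : evL β c3 = c ^ 3)
    (h : eqc (lI 4 0 • d) (d1 + c1 • dK s + c2 • (dK s * dK s) + c3 • (dK s * (dK s * dK s))) = true) :
    D.v2 β d = Δ (D.wv c) := by
  have e := h_eqc (D.s2 hβ) _ _ h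
  have hd : D.v2 β d1 = 1 := by
    rw [d1, D.v2_mt hβ, v1_1]
    rfl
  have h4 : (((4:Int):ℂ) + ((0:Int):ℂ) * β ^ 2) = 4 := by push_cast; ring
  simp only [h_add (D.s2 hβ), h_smul (D.s2 hβ), h_mul (D.s2 hβ), hK, hd, lI_ev, h4, h1, h2, h3] at e
  rw [wv, map_smul, map_add, map_add, map_add, map_smul, map_smul, map_smul, map_one, map_pow, map_pow,
    pow_two (Δ D.K), pow_succ' (Δ D.K), pow_two (Δ D.K), ← e, smul_smul,
    inv_mul_cancel₀ (by norm_num : (4:ℂ) ≠ 0), one_smul]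

theorem evM_congr {A S T : Type} [Ops A] [Ring S] [Algebra ℂ S] [Ring T] [Algebra ℂ T]
    (f : Q →ₗ[ℂ] S →ₗ[ℂ] T) (ev : A → S) (g : A → A) (hg : ∀ b, ev (g b) = ev b) (x : M A) :
    D.evM f ev (M.map g x) = D.evM f ev x := by
  refine D.evM_map f f ev g LinearMap.id ?_ x
  intro q b
  rw [hg, LinearMap.id_apply]

theorem nn (hβ : β ^ 4 = -1) (x : M2) : D.v2 β (M.nrm (M.map M.nrm x)) = D.v2 β x :=
  (D.evM_nrm (TensorProduct.mk ℂ Q Q) (D.s1 hβ) (M.map M.nrm x)).trans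
    (D.evM_congr (TensorProduct.mk ℂ Q Q) (D.v1 β) M.nrm
      (fun b => D.evM_nrm (fsm Q) (sndL β hβ) b) x)

theorem bsplit (a b : Bool) (h : (a && b) = true) : a = true ∧ b = true := by
  simpa using h

theorem hd (hβ : β ^ 4 = -1) (hs : evL β (ci s) = Complex.I) (hK : D.v2 β (dK s) = Δ D.K)
    (hE : D.v2 β (dE s) = Δ D.E) (hF : D.v2 β (dF s) = Δ D.F) : D.HD s β Δ := by
  have kw := bsplit _ _ (chk_w s)
  have k3 := kw.2
  have kw1 := bsplit _ _ kw.1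
  have k2 := kw1.2
  have kw2 := bsplit _ _ kw1.1
  have k0 := kw2.1
  have k1 := kw2.2
  have w0e : D.v2 β dw0 = Δ D.w0 := D.ev_dw hβ hK _ _ _ _ _ cO_ev (by rw [cO_ev, one_pow])
    (by rw [cO_ev, one_pow]) k0
  have w1e : D.v2 β dw1 = Δ D.w1 := D.ev_dw hβ hK _ _ _ _ _ (cni_ev hs)
    (by rw [cN_ev, neg_sq, Complex.I_sq]) (by rw [hs, In3]) k1
  have w2e : D.v2 β dw2 = Δ D.w2 := D.ev_dw hβ hK _ _ _ _ _ cN_ev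
    (by rw [cO_ev]; norm_num) (by rw [cN_ev]; norm_num) k2
  have w3e : D.v2 β dw3 = Δ D.w3 := D.ev_dw hβ hK _ _ _ _ _ hs
    (by rw [cN_ev, Complex.I_sq]) (by rw [cni_ev hs, I3]) k3
  have ha := h_add (D.s2 hβ)
  have hb := h_sub (D.s2 hβ)
  have hc := h_smul (D.s2 hβ)
  have hm := h_mul (D.s2 hβ)
  constructor
  · rw [dZ_0, D.nn hβ]
    simp only [ha, hb, hc, hm, w0e, w1e, w2e, w3e, hE, hF, cN_ev, neg_smul, one_smul, z0,
      map_add, map_sub, map_mul, map_neg]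
  · rw [dZ_1, D.nn hβ]
    simp only [ha, hb, hc, hm, w0e, w1e, w2e, w3e, hE, hF, cN_ev, neg_smul, one_smul, z1,
      map_add, map_sub, map_mul, map_neg]
  · rw [dZ_2, D.nn hβ]
    simp only [ha, hb, hc, hm, w0e, w1e, w2e, w3e, hE, hF, cN_ev, neg_smul, one_smul, z2,
      map_add, map_sub, map_mul, map_neg]
  · rw [dZ_3, D.nn hβ]
    simp only [ha, hb, hc, hm, w0e, w1e, w2e, w3e, hE, hF, cN_ev, neg_smul, one_smul, z3,
      map_add, map_sub, map_mul, map_neg]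
  · rw [dZ_4, D.nn hβ]
    simp only [ha, hb, hc, hm, w0e, w1e, w2e, w3e, hE, hF, cN_ev, neg_smul, one_smul, z4,
      map_add, map_sub, map_mul, map_neg]
  · rw [dZ_5, D.nn hβ]
    simp only [ha, hb, hc, hm, w0e, w1e, w2e, w3e, hE, hF, cN_ev, neg_smul, one_smul, z5,
      map_add, map_sub, map_mul, map_neg]
  · rw [dZ_6, D.nn hβ]
    simp only [ha, hb, hc, hm, w0e, w1e, w2e, w3e, hE, hF, cN_ev, neg_smul, one_smul, z6,
      map_add, map_sub, map_mul, map_neg]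
  · rw [dZ_7, D.nn hβ]
    simp only [ha, hb, hc, hm, w0e, w1e, w2e, w3e, hE, hF, cN_ev, neg_smul, one_smul, z7,
      map_add, map_sub, map_mul, map_neg]
  · rw [dP_0, D.nn hβ]
    simp only [ha, hb, hc, hm, w0e, w1e, w2e, w3e, hE, hF, cN_ev, neg_smul, one_smul, p0,
      map_add, map_sub, map_mul, map_neg]
  · rw [dP_1, D.nn hβ]
    simp only [ha, hb, hc, hm, w0e, w1e, w2e, w3e, hE, hF, cN_ev, neg_smul, one_smul, p1,
      map_add, map_sub, map_mul, map_neg]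
  · rw [dP_2, D.nn hβ]
    simp only [ha, hb, hc, hm, w0e, w1e, w2e, w3e, hE, hF, cN_ev, neg_smul, one_smul, p2,
      map_add, map_sub, map_mul, map_neg]
  · rw [dP_3, D.nn hβ]
    simp only [ha, hb, hc, hm, w0e, w1e, w2e, w3e, hE, hF, cN_ev, neg_smul, one_smul, p3,
      map_add, map_sub, map_mul, map_neg]
  · rw [dM_0, D.nn hβ]
    simp only [ha, hb, hc, hm, w0e, w1e, w2e, w3e, hE, hF, cN_ev, neg_smul, one_smul, n0,
      map_add, map_sub, map_mul, map_neg]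
  · rw [dM_1, D.nn hβ]
    simp only [ha, hb, hc, hm, w0e, w1e, w2e, w3e, hE, hF, cN_ev, neg_smul, one_smul, n1,
      map_add, map_sub, map_mul, map_neg]
  · rw [dM_2, D.nn hβ]
    simp only [ha, hb, hc, hm, w0e, w1e, w2e, w3e, hE, hF, cN_ev, neg_smul, one_smul, n2,
      map_add, map_sub, map_mul, map_neg]
  · rw [dM_3, D.nn hβ]
    simp only [ha, hb, hc, hm, w0e, w1e, w2e, w3e, hE, hF, cN_ev, neg_smul, one_smul, n3,
      map_add, map_sub, map_mul, map_neg]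

/-! ### The axioms -/

theorem copL_mul (x y : TP2 ℂ Q) : copL Δ (x * y) = copL Δ x * copL Δ y :=
  map_mul ((Algebra.TensorProduct.assoc ℂ ℂ ℂ Q Q Q).toAlgHom.comp
    (Algebra.TensorProduct.map Δ (AlgHom.id ℂ Q))) x y
theorem copR_mul (x y : TP2 ℂ Q) : copR Δ (x * y) = copR Δ x * copR Δ y :=
  map_mul (Algebra.TensorProduct.map (AlgHom.id ℂ Q) Δ) x y
theorem flip_mul (x y : TP2 ℂ Q) : flipA ℂ Q (x * y) = flipA ℂ Q x * flipA ℂ Q y :=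
  map_mul (Algebra.TensorProduct.comm ℂ Q Q) x y
theorem p132_mul (x y : TP3 ℂ Q) : perm132 ℂ Q (x * y) = perm132 ℂ Q x * perm132 ℂ Q y :=
  map_mul (Algebra.TensorProduct.map (AlgHom.id ℂ Q) (Algebra.TensorProduct.comm ℂ Q Q).toAlgHom) x y
theorem p213_mul (x y : TP3 ℂ Q) : perm213 ℂ Q (x * y) = perm213 ℂ Q x * perm213 ℂ Q y :=
  map_mul ((Algebra.TensorProduct.assoc ℂ ℂ ℂ Q Q Q).toAlgHom.comp
    ((Algebra.TensorProduct.map (Algebra.TensorProduct.comm ℂ Q Q).toAlgHom (AlgHom.id ℂ Q)).comp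
      (Algebra.TensorProduct.assoc ℂ ℂ ℂ Q Q Q).symm.toAlgHom)) x y
theorem copL_one : copL Δ 1 = 1 :=
  map_one ((Algebra.TensorProduct.assoc ℂ ℂ ℂ Q Q Q).toAlgHom.comp
    (Algebra.TensorProduct.map Δ (AlgHom.id ℂ Q)))
theorem copR_one : copR Δ 1 = 1 := map_one (Algebra.TensorProduct.map (AlgHom.id ℂ Q) Δ)

end

/-- The pentagon, in an abstract target. -/
theorem pent {Q : Type} [Ring Q] [Algebra ℂ Q] (D : QD Q) {β : ℂ} {s : Bool} {Δ : Q →ₐ[ℂ] TP2 ℂ Q}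
    (hβ : β ^ 4 = -1) (hD : D.HD s β Δ) {T : Type} [Ring T] [Algebra ℂ T]
    (f : Q →ₗ[ℂ] TP3 ℂ Q →ₗ[ℂ] T) (hf : HF f) (J : TP2 ℂ Q →ₗ[ℂ] TP2 ℂ Q →ₗ[ℂ] T)
    (hJ : ∀ q q' s, J (q ⊗ₜ q') s = f q (q' ⊗ₜ s))
    (φ1 φ2 φ3 φp : TP3 ℂ Q →ₗ[ℂ] T) (h1 : ∀ q s, φ1 (q ⊗ₜ s) = J (Δ q) s)
    (h2 : ∀ q s, φ2 (q ⊗ₜ s) = f q (copL Δ s)) (h3 : ∀ q s, φ3 (q ⊗ₜ s) = f q (copR Δ s))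
    (hp : ∀ q s, φp (q ⊗ₜ s) = f q (emb12 ℂ Q s)) (x : M3) (P : TP3 ℂ Q) (hx : D.v3 β x = P)
    (h : eqc (mcop s x * M.map (M.map (mcop s)) x)
      (M.map (M.map (M.map (fun c => Ops.smul c m1))) x * M.map (mcop s) x * M.t m1 x) = true) :
    φ1 P * φ3 P = φp P * φ2 P * f 1 P := by
  have h4 : Snd (evL β) (D.evM f (D.v3 β)) := D.sndM f (D.s3 hβ) hf
  have e := h_eqc h4 _ _ h
  rw [h_mul h4, h_mul h4, h_mul h4] at e
  have hmap (ψ : TP2 ℂ Q → TP3 ℂ Q) (φ : TP3 ℂ Q →ₗ[ℂ] T) (g : M2 → M3)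
      (hg : ∀ b, D.v3 β (g b) = ψ (D.v2 β b)) (hφ : ∀ q s, φ (q ⊗ₜ s) = f q (ψ s)) :
      D.evM f (D.v3 β) (M.map g x) = φ (D.v3 β x) := by
    refine D.evM_map f (TensorProduct.mk ℂ Q (TP2 ℂ Q)) (D.v2 β) g φ ?_ x
    intro q b
    rw [hg]
    exact (hφ _ _).symm
  have e1 : D.evM f (D.v3 β) (mcop s x) = φ1 (D.v3 β x) :=
    D.ev_mcop (TensorProduct.mk ℂ Q (TP2 ℂ Q)) f J hβ (D.s2 hβ) (hf_mk _) hf hJ hD φ1 h1 x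
  have e2 : D.evM f (D.v3 β) (M.map (M.map (mcop s)) x) = φ3 (D.v3 β x) :=
    hmap (copR Δ) φ3 (M.map (mcop s)) (D.copR2 hβ hD) h3
  have e3 : D.evM f (D.v3 β) (M.map (M.map (M.map (fun c => Ops.smul c m1))) x) = φp (D.v3 β x) :=
    hmap (emb12 ℂ Q) φp (M.map (M.map (fun c => Ops.smul c m1))) (D.ev_r12 hβ) hp
  have e4 : D.evM f (D.v3 β) (M.map (mcop s) x) = φ2 (D.v3 β x) :=
    hmap (copL Δ) φ2 (mcop s) (D.cop2 hβ hD) h2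
  have e5 : D.evM f (D.v3 β) (M.t m1 x) = f 1 (D.v3 β x) := by
    refine (D.evM_t f (sndL β hβ) (D.s3 hβ) m1 x).trans ?_
    exact congrArg (fun q => f q (D.v3 β x)) D.v1_1
  rw [e1, e2, e3, e4, e5, hx] at e
  exact e

section
variable {Q : Type} [Ring Q] [Algebra ℂ Q] (D : QD Q) {β : ℂ} {s : Bool} {Δ : Q →ₐ[ℂ] TP2 ℂ Q}

theorem pent4 (hβ : β ^ 4 = -1) (hD : D.HD s β Δ) (x : M3) (P : TP3 ℂ Q) (hx : D.v3 β x = P)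
    (h : eqc (mcop s x * M.map (M.map (mcop s)) x)
      (M.map (M.map (M.map (fun c => Ops.smul c m1))) x * M.map (mcop s) x * M.t m1 x) = true) :
    cop4_1 Δ P * cop4_3 Δ P = pad4 P * cop4_2 Δ P * ((1:Q) ⊗ₜ[ℂ] P) := by
  have k := D.pent (T := TP4 ℂ Q) hβ hD (TensorProduct.mk ℂ Q (TP3 ℂ Q)) (hf_mk _)
    ((TensorProduct.mk ℂ (TP2 ℂ Q) (TP2 ℂ Q)).compr₂ (TensorProduct.assoc ℂ Q Q (TP2 ℂ Q)).toLinearMap)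
    (fun _ _ _ => rfl) (cop4_1 Δ) (cop4_2 Δ) (cop4_3 Δ) (pad4 : TP3 ℂ Q →ₗ[ℂ] TP4 ℂ Q)
    (fun _ _ => rfl) (fun _ _ => rfl) (fun _ _ => rfl) (fun _ _ => rfl) x P hx h
  exact k

theorem one2 (hβ : β ^ 4 = -1) : D.v2 β (mt2 m1 m1) = 1 := by
  rw [D.v2_mt hβ, v1_1]
  rfl
theorem one3 (hβ : β ^ 4 = -1) : D.v3 β (mt3 m1 m1 m1) = 1 := by
  rw [D.v3_mt hβ, v1_1]
  rfl

theorem inv2 (hβ : β ^ 4 = -1) (x y : M2) (h : eqc (x * y) (mt2 m1 m1) = true) :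
    D.v2 β x * D.v2 β y = 1 := by
  have e := h_eqc (D.s2 hβ) _ _ h
  rw [h_mul (D.s2 hβ), D.one2 hβ] at e
  exact e
theorem inv3 (hβ : β ^ 4 = -1) (x y : M3) (h : eqc (x * y) (mt3 m1 m1 m1) = true) :
    D.v3 β x * D.v3 β y = 1 := by
  have e := h_eqc (D.s3 hβ) _ _ h
  rw [h_mul (D.s3 hβ), D.one3 hβ] at e
  exact e

theorem one213 : perm213 ℂ Q 1 = 1 := rfl
theorem one132 : perm132 ℂ Q 1 = 1 := rfl
theorem e213 (x y : TP3 ℂ Q) (h : x * y = 1) : perm213 ℂ Q x * perm213 ℂ Q y = 1 := by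
  rw [← p213_mul, h, one213]
theorem e231 (x y : TP3 ℂ Q) (h : x * y = 1) : perm231 ℂ Q x * perm231 ℂ Q y = 1 := by
  rw [perm231_eq, LinearMap.comp_apply, LinearMap.comp_apply, ← p132_mul, e213 x y h, one132]

theorem hex1 (hβ : β ^ 4 = -1) (hD : D.HD s β Δ) (x y : M3) (r : M2) (P : TP3 ℂ Q) (R : TP2 ℂ Q)
    (hP : D.v3 β x = P) (hR : D.v2 β r = R) (P1 : P * D.v3 β y = 1) (P2 : D.v3 β y * P = 1)
    (h : eqc (p231 x * mcop s r * x) (r13 r * p132 x * r23 r) = true) :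
    copL Δ R = Ring.inverse (perm231 ℂ Q P) * emb13 ℂ Q R * perm132 ℂ Q P *
        emb23 ℂ Q R * Ring.inverse P := by
  have uP : IsUnit P := ⟨⟨_, _, P1, P2⟩, rfl⟩
  have u231 : IsUnit (perm231 ℂ Q P) := ⟨⟨_, _, e231 _ _ P1, e231 _ _ P2⟩, rfl⟩
  have e := h_eqc (D.s3 hβ) _ _ h
  rw [h_mul (D.s3 hβ), h_mul (D.s3 hβ), h_mul (D.s3 hβ), h_mul (D.s3 hβ), D.ev_p231 hβ, D.ev_p132 hβ,
    D.ev_r13 hβ, D.ev_r23 hβ, D.cop2 hβ hD, hR, hP] at e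
  have e2 := congrArg (fun X => Ring.inverse (perm231 ℂ Q P) * X * Ring.inverse P) e
  simp only [← mul_assoc] at e2
  rw [Ring.inverse_mul_cancel _ u231, one_mul, mul_assoc, Ring.mul_inverse_cancel _ uP, mul_one] at e2
  exact e2

theorem hex2 (hβ : β ^ 4 = -1) (hD : D.HD s β Δ) (x y : M3) (r : M2) (P : TP3 ℂ Q) (R : TP2 ℂ Q)
    (hP : D.v3 β x = P) (hR : D.v2 β r = R) (P1 : P * D.v3 β y = 1) (P2 : D.v3 β y * P = 1)
    (h : eqc (M.map (mcop s) r) (p312 x * r13 r * p213 y * r12 r * x) = true) :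
    copR Δ R = perm312 ℂ Q P * emb13 ℂ Q R * Ring.inverse (perm213 ℂ Q P) *
        emb12 ℂ Q R * P := by
  have i213 : Ring.inverse (perm213 ℂ Q P) = perm213 ℂ Q (D.v3 β y) := by
    have u : IsUnit (perm213 ℂ Q P) := ⟨⟨_, _, e213 _ _ P1, e213 _ _ P2⟩, rfl⟩
    have h := Ring.inverse_mul_cancel _ u
    rw [← mul_one (Ring.inverse _), ← e213 _ _ P1, ← mul_assoc, h, one_mul]
  have e := h_eqc (D.s3 hβ) _ _ h
  rw [h_mul (D.s3 hβ), h_mul (D.s3 hβ), h_mul (D.s3 hβ), h_mul (D.s3 hβ), D.ev_p312 hβ, D.sw3 hβ,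
    D.ev_r13 hβ, D.ev_r12 hβ, D.copR2 hβ hD, hR, hP] at e
  rw [i213]
  exact e

theorem cu (hβ : β ^ 4 = -1) (ce : Q →ₐ[ℂ] ℂ) (hE : ce D.E = 0) (hF : ce D.F = 0)
    (hK : ce D.K = 1) (x : M3) (h : eqc (M.map (M.pz 0) x) (mt2 m1 m1) = true) :
    cuMid ce (D.v3 β x) = 1 := by
  have e := h_eqc (D.s2 hβ) _ _ h
  rw [D.ev_cu hβ ce hE hF hK, D.one2 hβ] at e
  exact e

theorem int1 (hβ : β ^ 4 = -1) (hD : D.HD s β Δ) (x : M3) (d : M2) (a : Q) (P : TP3 ℂ Q)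
    (hP : D.v3 β x = P) (hd : D.v2 β d = Δ a)
    (h : eqc (mcop s d * x) (x * M.map (mcop s) d) = true) :
    copL Δ (Δ a) * P = P * copR Δ (Δ a) := by
  have e := h_eqc (D.s3 hβ) _ _ h
  rw [h_mul (D.s3 hβ), h_mul (D.s3 hβ), D.cop2 hβ hD, D.copR2 hβ hD, hP, hd] at e
  exact e

theorem op1 (hβ : β ^ 4 = -1) (r d : M2) (a : Q) (R : TP2 ℂ Q)
    (hR : D.v2 β r = R) (hd : D.v2 β d = Δ a) (h : eqc (r * d) (M.swap d * r) = true) :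
    R * Δ a = flipA ℂ Q (Δ a) * R := by
  have e := h_eqc (D.s2 hβ) _ _ h
  rw [h_mul (D.s2 hβ), h_mul (D.s2 hβ), D.sw2 hβ, hR, hd] at e
  exact e

theorem int_all (hgen : ∀ a : Q, a ∈ Algebra.adjoin ℂ {D.E, D.F, D.K}) (P : TP3 ℂ Q)
    (e1 : copL Δ (Δ D.E) * P = P * copR Δ (Δ D.E)) (e2 : copL Δ (Δ D.F) * P = P * copR Δ (Δ D.F))
    (e3 : copL Δ (Δ D.K) * P = P * copR Δ (Δ D.K)) (a : Q) :
    copL Δ (Δ a) * P = P * copR Δ (Δ a) := by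
  refine Algebra.adjoin_induction (p := fun a _ => copL Δ (Δ a) * P =
    P * copR Δ (Δ a)) ?_ ?_ ?_ ?_ (hgen a)
  · intro x hx
    rcases hx with rfl | rfl | rfl
    · exact e1
    · exact e2
    · exact e3
  · intro r
    rw [Algebra.algebraMap_eq_smul_one, map_smul, map_one, map_smul, map_smul, copL_one, copR_one,
      smul_mul_assoc, mul_smul_comm, one_mul, mul_one]
  · intro x y _ _ hx hy
    rw [map_add, map_add, map_add, add_mul, mul_add, hx, hy]
  · intro x y _ _ hx hy
    rw [map_mul, copL_mul, copR_mul, mul_assoc, hy, ← mul_assoc, hx, mul_assoc]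

theorem flip_one : flipA ℂ Q 1 = 1 := rfl
theorem op_all (hgen : ∀ a : Q, a ∈ Algebra.adjoin ℂ {D.E, D.F, D.K}) (R : TP2 ℂ Q)
    (e1 : R * Δ D.E = flipA ℂ Q (Δ D.E) * R) (e2 : R * Δ D.F = flipA ℂ Q (Δ D.F) * R)
    (e3 : R * Δ D.K = flipA ℂ Q (Δ D.K) * R) (a : Q) : R * Δ a = flipA ℂ Q (Δ a) * R := by
  refine Algebra.adjoin_induction (p := fun a _ => R * Δ a = flipA ℂ Q (Δ a) * R)
    ?_ ?_ ?_ ?_ (hgen a)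
  · intro x hx
    rcases hx with rfl | rfl | rfl
    · exact e1
    · exact e2
    · exact e3
  · intro r
    rw [Algebra.algebraMap_eq_smul_one, map_smul, map_one, map_smul, flip_one, smul_mul_assoc,
      mul_smul_comm, one_mul, mul_one]
  · intro x y _ _ hx hy
    rw [map_add, map_add, add_mul, mul_add, hx, hy]
  · intro x y _ _ hx hy
    rw [map_mul, flip_mul, ← mul_assoc, hx, mul_assoc, hy, mul_assoc]
end

theorem main {Q : Type} [Ring Q] [Algebra ℂ Q] (D : QD Q) (β : ℂ) (hβ : β ^ 4 = -1)
    (hgen : ∀ a : Q, a ∈ Algebra.adjoin ℂ {D.E, D.F, D.K})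
    (Δ : Q →ₐ[ℂ] TP2 ℂ Q)
    (hΔE : Δ D.E = (1:Q) ⊗ₜ[ℂ] D.E + D.E ⊗ₜ[ℂ] D.K)
    (hΔF : Δ D.F = (D.K ^ 3) ⊗ₜ[ℂ] D.F + D.F ⊗ₜ[ℂ] (1:Q))
    (hΔK : Δ D.K = D.K ⊗ₜ[ℂ] D.K)
    (ce : Q →ₐ[ℂ] ℂ) (hceE : ce D.E = 0) (hceF : ce D.F = 0) (hceK : ce D.K = 1) :
    copL Δ (D.aRmat β) =
      Ring.inverse (perm231 ℂ Q (D.aPhi β)) * emb13 ℂ Q (D.aRmat β) * perm132 ℂ Q (D.aPhi β) *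
        emb23 ℂ Q (D.aRmat β) * Ring.inverse (D.aPhi β) ∧
    copR Δ (D.aRmat β) =
      perm312 ℂ Q (D.aPhi β) * emb13 ℂ Q (D.aRmat β) * Ring.inverse (perm213 ℂ Q (D.aPhi β)) *
        emb12 ℂ Q (D.aRmat β) * D.aPhi β ∧
    IsUnit (D.aPhi β) ∧
    cuMid ce (D.aPhi β) = 1 ∧
    (∀ a : Q, copL Δ (Δ a) = D.aPhi β * copR Δ (Δ a) * Ring.inverse (D.aPhi β)) ∧
    cop4_1 Δ (D.aPhi β) * cop4_3 Δ (D.aPhi β) =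
      pad4 (D.aPhi β) * cop4_2 Δ (D.aPhi β) * ((1:Q) ⊗ₜ[ℂ] D.aPhi β) ∧
    IsUnit (D.aRmat β) ∧
    (∀ a : Q, D.aRmat β * Δ a = flipA ℂ Q (Δ a) * D.aRmat β) := by
  have hs : ∃ s, evL β (ci s) = Complex.I := by
    have h : (β ^ 2 - Complex.I) * (β ^ 2 + Complex.I) = 0 := by
      linear_combination hβ - Complex.I_sq
    rcases mul_eq_zero.mp h with h | h
    · exact ⟨true, by simp [ci, evL, evG]; linear_combination h⟩
    · exact ⟨false, by simp [ci, evL, evG]; linear_combination -h⟩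
  obtain ⟨s, hs⟩ := hs
  have hdE := D.ev_dE hβ hs hΔE
  have hdF := D.ev_dF hβ hs hΔF
  have hdK := D.ev_dK hβ hs hΔK
  have hD := D.hd hβ hs hdK hdE hdF
  have hR := D.ev_R hβ hs
  have hP := D.ev_Phi hβ hs
  have kR := bsplit _ _ (chk_RI s)
  have kP := bsplit _ _ (chk_PhiI s)
  have kI := bsplit _ _ (chk_int s)
  have kI1 := bsplit _ _ kI.1
  have kO := bsplit _ _ (chk_op s)
  have kO1 := bsplit _ _ kO.1
  have R1 := D.inv2 hβ _ _ kR.1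
  have R2 := D.inv2 hβ _ _ kR.2
  have P1 := D.inv3 hβ _ _ kP.1
  have P2 := D.inv3 hβ _ _ kP.2
  have h1 := D.hex1 hβ hD _ _ _ _ _ hP hR (hP ▸ P1) (hP ▸ P2) (chk_hex1 s)
  have h2 := D.hex2 hβ hD _ _ _ _ _ hP hR (hP ▸ P1) (hP ▸ P2) (chk_hex2 s)
  have h3 := D.cu hβ ce hceE hceF hceK _ (chk_cu s)
  have h4 := D.pent4 hβ hD _ _ hP (chk_pent s)
  have h5 := D.int_all hgen _ (D.int1 hβ hD _ _ _ _ hP hdE kI1.1) (D.int1 hβ hD _ _ _ _ hP hdF kI1.2)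
    (D.int1 hβ hD _ _ _ _ hP hdK kI.2)
  have h6 := D.op_all hgen _ (D.op1 hβ _ _ _ _ hR hdE kO1.1) (D.op1 hβ _ _ _ _ hR hdF kO1.2)
    (D.op1 hβ _ _ _ _ hR hdK kO.2)
  rw [hP] at P1 P2 h3
  rw [hR] at R1 R2
  have uP : IsUnit (D.aPhi β) := ⟨⟨_, _, P1, P2⟩, rfl⟩
  refine ⟨h1, h2, uP, h3, ?_, h4, ⟨⟨_, _, R1, R2⟩, rfl⟩, h6⟩
  intro a
  rw [← h5, mul_assoc, Ring.mul_inverse_cancel _ uP, mul_one]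
end QD

/-! ### The concrete algebra -/

theorem gen_rel {A : Type} [Ring A] [Algebra ℂ A] (K Ki : A) (h1 : K * Ki = 1) (h4 : K ^ 4 = 1) :
    Ki = K ^ 3 := by
  have h : K ^ 3 * K = 1 := by rw [← pow_succ, h4]
  calc Ki = K ^ 3 * K * Ki := by rw [h, one_mul]
    _ = K ^ 3 := by rw [mul_assoc, h1, mul_one]

theorem gen_comm {A : Type} [Ring A] (E K Ki : A) (h2 : Ki * K = 1) (h : K * E * Ki = -E) :
    K * E = -(E * K) := by
  have e := congrArg (fun x => x * K) h
  simp only [mul_assoc, h2, mul_one, neg_mul] at e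
  exact e

theorem relKKi : gK * gKi = 1 := by
  have h := RingQuot.mkAlgHom_rel ℂ QRel.KKi
  rw [map_mul, map_one] at h
  exact h
theorem relKiK : gKi * gK = 1 := by
  have h := RingQuot.mkAlgHom_rel ℂ QRel.KiK
  rw [map_mul, map_one] at h
  exact h
theorem relKE : gK * gE * gKi = -gE := by
  have h := RingQuot.mkAlgHom_rel ℂ QRel.KEKi
  rw [map_mul, map_mul, map_neg] at h
  exact h
theorem relKF : gK * gF * gKi = -gF := by
  have h := RingQuot.mkAlgHom_rel ℂ QRel.KFKi
  rw [map_mul, map_mul, map_neg] at h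
  exact h
theorem relEF : gE * gF - gF * gE = (2 * Complex.I)⁻¹ • (gK - gKi) := by
  have h := RingQuot.mkAlgHom_rel ℂ QRel.EF
  rw [map_sub, map_mul, map_mul, map_smul, map_sub] at h
  exact h
theorem relE : gE * gE = 0 := by
  have h := RingQuot.mkAlgHom_rel ℂ QRel.Esq
  rw [map_pow, map_zero, pow_two] at h
  exact h
theorem relF : gF * gF = 0 := by
  have h := RingQuot.mkAlgHom_rel ℂ QRel.Fsq
  rw [map_pow, map_zero, pow_two] at h
  exact h
theorem relK4 : gK ^ 4 = 1 := by
  have h := RingQuot.mkAlgHom_rel ℂ QRel.K4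
  rw [map_pow, map_one] at h
  exact h
theorem gKi_eq : gKi = gK ^ 3 := gen_rel gK gKi relKKi relK4

theorem gen_adj (a : Q) : a ∈ Algebra.adjoin ℂ {gE, gF, gK} := by
  have hE : gE ∈ Algebra.adjoin ℂ {gE, gF, gK} := Algebra.subset_adjoin (by simp)
  have hF : gF ∈ Algebra.adjoin ℂ {gE, gF, gK} := Algebra.subset_adjoin (by simp)
  have hK : gK ∈ Algebra.adjoin ℂ {gE, gF, gK} := Algebra.subset_adjoin (by simp)
  have hKi : gKi ∈ Algebra.adjoin ℂ {gE, gF, gK} := by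
    rw [gKi_eq]
    exact pow_mem hK 3
  obtain ⟨x, rfl⟩ := RingQuot.mkAlgHom_surjective ℂ QRel a
  induction x using FreeAlgebra.induction with
  | grade0 r =>
    rw [AlgHom.commutes]
    exact algebraMap_mem _ r
  | grade1 g =>
    cases g
    · exact hE
    · exact hF
    · exact hK
    · exact hKi
  | mul x y hx hy =>
    rw [map_mul]
    exact mul_mem hx hy
  | add x y hx hy =>
    rw [map_add]
    exact add_mem hx hy

/-- The quantum group, as an instance of the abstract presentation. -/
def Dq : QD Q where
  E := gE
  F := gF
  K := gK
  K4 := relK4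
  KE := gen_comm gE gK gKi relKiK relKE
  KF := gen_comm gF gK gKi relKiK relKF
  EE := relE
  FF := relF
  EF := by
    rw [← gKi_eq]
    exact relEF

theorem Dq_Phi (β : ℂ) : Dq.aPhi β = Phi β := rfl
theorem Dq_R (β : ℂ) : Dq.aRmat β = Rmat β := rfl


/-- The abstract theorem with `Φ`, `R` replaced by variables. -/
theorem QD.main_gen {Q : Type} [Ring Q] [Algebra ℂ Q] (D : QD Q) (β : ℂ) (hβ : β ^ 4 = -1)
    (hgen : ∀ a : Q, a ∈ Algebra.adjoin ℂ {D.E, D.F, D.K})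
    (Δ : Q →ₐ[ℂ] TP2 ℂ Q)
    (hΔE : Δ D.E = (1:Q) ⊗ₜ[ℂ] D.E + D.E ⊗ₜ[ℂ] D.K)
    (hΔF : Δ D.F = (D.K ^ 3) ⊗ₜ[ℂ] D.F + D.F ⊗ₜ[ℂ] (1:Q))
    (hΔK : Δ D.K = D.K ⊗ₜ[ℂ] D.K)
    (ce : Q →ₐ[ℂ] ℂ) (hceE : ce D.E = 0) (hceF : ce D.F = 0) (hceK : ce D.K = 1)
    (P : TP3 ℂ Q) (R : TP2 ℂ Q) (hP : D.aPhi β = P) (hR : D.aRmat β = R) :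
    copL Δ R =
      Ring.inverse (perm231 ℂ Q P) * emb13 ℂ Q R * perm132 ℂ Q P *
        emb23 ℂ Q R * Ring.inverse P ∧
    copR Δ R =
      perm312 ℂ Q P * emb13 ℂ Q R * Ring.inverse (perm213 ℂ Q P) *
        emb12 ℂ Q R * P ∧
    IsUnit P ∧
    cuMid ce P = 1 ∧
    (∀ a : Q, copL Δ (Δ a) = P * copR Δ (Δ a) * Ring.inverse P) ∧
    cop4_1 Δ P * cop4_3 Δ P =
      pad4 P * cop4_2 Δ P * ((1:Q) ⊗ₜ[ℂ] P) ∧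
    IsUnit R ∧
    (∀ a : Q, R * Δ a = flipA ℂ Q (Δ a) * R) := by
  subst hP hR
  exact D.main β hβ hgen Δ hΔE hΔF hΔK ce hceE hceF hceK

theorem statement9_aux (β : ℂ) (hβ : β ^ 4 = -1)
    (Δ : Q →ₐ[ℂ] TP2 ℂ Q)
    (hΔE : Δ gE = (1:Q) ⊗ₜ[ℂ] gE + gE ⊗ₜ[ℂ] gK)
    (hΔF : Δ gF = gKi ⊗ₜ[ℂ] gF + gF ⊗ₜ[ℂ] (1:Q))
    (hΔK : Δ gK = gK ⊗ₜ[ℂ] gK)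
    (ce : Q →ₐ[ℂ] ℂ) (hceE : ce gE = 0) (hceF : ce gF = 0) (hceK : ce gK = 1)
    (P : TP3 ℂ Q) (R : TP2 ℂ Q) (hP : Dq.aPhi β = P) (hR : Dq.aRmat β = R) :
    copL Δ R =
      Ring.inverse (perm231 ℂ Q P) * emb13 ℂ Q R * perm132 ℂ Q P *
        emb23 ℂ Q R * Ring.inverse P ∧
    copR Δ R =
      perm312 ℂ Q P * emb13 ℂ Q R * Ring.inverse (perm213 ℂ Q P) *
        emb12 ℂ Q R * P ∧
    IsUnit P ∧
    cuMid ce P = 1 ∧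
    (∀ a : Q, copL Δ (Δ a) = P * copR Δ (Δ a) * Ring.inverse P) ∧
    cop4_1 Δ P * cop4_3 Δ P =
      pad4 P * cop4_2 Δ P * ((1:Q) ⊗ₜ[ℂ] P) ∧
    IsUnit R ∧
    (∀ a : Q, R * Δ a = flipA ℂ Q (Δ a) * R) := by
  rw [gKi_eq] at hΔF
  exact Dq.main_gen β hβ gen_adj Δ hΔE hΔF hΔK ce hceE hceF hceK P R hP hR

/-- `(Q, Φ, R)` satisfies the two hexagon identities, and together
with the other verified axioms is a quasi-triangular quasi-bialgebra. -/
theorem statement9 (β : ℂ) (hβ : β ^ 4 = -1)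
    (Δ : Q →ₐ[ℂ] TP2 ℂ Q)
    (hΔE : Δ gE = (1:Q) ⊗ₜ[ℂ] gE + gE ⊗ₜ[ℂ] gK)
    (hΔF : Δ gF = gKi ⊗ₜ[ℂ] gF + gF ⊗ₜ[ℂ] (1:Q))
    (hΔK : Δ gK = gK ⊗ₜ[ℂ] gK)
    (ce : Q →ₐ[ℂ] ℂ) (hceE : ce gE = 0) (hceF : ce gF = 0) (hceK : ce gK = 1) :
    copL Δ (Rmat β) =
      Ring.inverse (perm231 ℂ Q (Phi β)) * emb13 ℂ Q (Rmat β) * perm132 ℂ Q (Phi β) *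
        emb23 ℂ Q (Rmat β) * Ring.inverse (Phi β) ∧
    copR Δ (Rmat β) =
      perm312 ℂ Q (Phi β) * emb13 ℂ Q (Rmat β) * Ring.inverse (perm213 ℂ Q (Phi β)) *
        emb12 ℂ Q (Rmat β) * Phi β ∧
    IsUnit (Phi β) ∧
    cuMid ce (Phi β) = 1 ∧
    (∀ a : Q, copL Δ (Δ a) = Phi β * copR Δ (Δ a) * Ring.inverse (Phi β)) ∧
    cop4_1 Δ (Phi β) * cop4_3 Δ (Phi β) =
      pad4 (Phi β) * cop4_2 Δ (Phi β) * ((1:Q) ⊗ₜ[ℂ] Phi β) ∧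
    IsUnit (Rmat β) ∧
    (∀ a : Q, Rmat β * Δ a = flipA ℂ Q (Δ a) * Rmat β) :=
  statement9_aux β hβ Δ hΔE hΔF hΔK ce hceE hceF hceK (Phi β) (Rmat β) (Dq_Phi β) (Dq_R β)
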